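/- There exists ε > 0 and N such that for every odd n ≥ N the following holds: if A, B, C, D are four independent random balanced n-sided dice, each with law μ_n, then the probability that the "beats" relation on {A,B,C,D} is transitive — i.e., there is a permutation σ of {1,2,3,4} such that the σ(i)-th die beats the σ(j)-th die whenever i < j — is strictly greater than 3/8 + ε. -/

import Mathlib

open MeasureTheory ProbabilityTheory Set

/-- Extend a vector of `n-1` faces to an `n`-face die whose last face makes the
face-sum equal to `s`. -/
noncomputable def extendDie (n : ℕ) (s : ℝ) (a : Fin (n - 1) → ℝ) : Fin n → ℝ :=
  fun i => if h : (i : ℕ) < n - 1 then a ⟨i, h⟩ else s - ∑ j, a j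

/-- The balanced-dice measure on `[lo,hi]^n` with face-sum `s`: the law of
`(a_1,…,a_{n-1},a_n)` where `(a_1,…,a_{n-1})` is uniform on `[lo,hi]^{n-1}`
conditioned on `s - Σ a_i ∈ [lo,hi]`, and `a_n := s - Σ_{i<n} a_i`. -/
noncomputable def diceMeasure (n : ℕ) (lo hi s : ℝ) : Measure (Fin n → ℝ) :=
  Measure.map (extendDie n s)
    (ProbabilityTheory.cond volume
      {a : Fin (n - 1) → ℝ | (∀ i, a i ∈ Set.Icc lo hi) ∧ (s - ∑ i, a i) ∈ Set.Icc lo hi})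

/-- Die `A` beats die `B`. -/
def beats {n : ℕ} (A B : Fin n → ℝ) : Prop :=
  0 < ∑ i : Fin n, ∑ j : Fin n,
      ((if B j < A i then (1 : ℝ) else 0) - (if A i < B j then (1 : ℝ) else 0))

/-- The "beats" relation on four dice is transitive, i.e. realizes a transitive
tournament. -/
def transitiveOnFour {n : ℕ} (D : Fin 4 → Fin n → ℝ) : Prop :=
  ∃ σ : Equiv.Perm (Fin 4), ∀ i j : Fin 4, i < j → beats (D (σ i)) (D (σ j))


open MeasureTheory ProbabilityTheory Set

/-- Density of a sum of `k+1` independent centered uniforms. -/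
noncomputable def pk : ℕ → ℝ → ℝ
  | 0 => Set.indicator (Set.Icc (-1/2) (1/2)) (fun _ => 1)
  | k + 1 => fun t => ∫ u in (t - 1/2)..(t + 1/2), pk k u

lemma pk_succ (k : ℕ) (t : ℝ) : pk (k+1) t = ∫ u in (t - 1/2)..(t + 1/2), pk k u := rfl

lemma pk_basic (k : ℕ) : Measurable (pk k) ∧ (∀ t, 0 ≤ pk k t) ∧ (∀ t, pk k t ≤ 1) := by
  induction k with
  | zero =>
    refine ⟨measurable_const.indicator measurableSet_Icc, fun t => ?_, fun t => ?_⟩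
    · exact Set.indicator_nonneg (fun _ _ => zero_le_one) _
    · exact Set.indicator_le_self' (fun _ _ => zero_le_one) _
  | succ k ih =>
    obtain ⟨hm, h0, h1⟩ := ih
    have hitg : ∀ a b, IntervalIntegrable (pk k) volume a b := by
      intro a b
      rw [intervalIntegrable_iff]
      refine Measure.integrableOn_of_bounded (M := 1) (by simp) hm.aestronglyMeasurable ?_
      refine Filter.Eventually.of_forall fun x => ?_
      rw [Real.norm_eq_abs, abs_le]
      exact ⟨by linarith [h0 x], h1 x⟩
    refine ⟨?_, fun t => ?_, fun t => ?_⟩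
    · have hc : Continuous (fun t => ∫ u in (0:ℝ)..t, pk k u) :=
        intervalIntegral.continuous_primitive hitg 0
      have : pk (k+1) = fun t => (∫ u in (0:ℝ)..(t+1/2), pk k u) - ∫ u in (0:ℝ)..(t-1/2), pk k u := by
        funext t
        rw [pk_succ, intervalIntegral.integral_interval_sub_left (hitg _ _) (hitg _ _)]
      rw [this]
      exact ((hc.comp (by fun_prop)).sub (hc.comp (by fun_prop))).measurable
    · exact intervalIntegral.integral_nonneg (by linarith) fun u _ => h0 u
    · rw [pk_succ]
      calc _ ≤ ∫ u in (t - 1/2)..(t + 1/2), (1:ℝ) :=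
            intervalIntegral.integral_mono (by linarith) (hitg _ _) (by simp) fun u => h1 u
        _ = 1 := by simp; norm_num

lemma pk_meas (k : ℕ) : Measurable (pk k) := (pk_basic k).1
lemma pk_nonneg (k : ℕ) (t : ℝ) : 0 ≤ pk k t := (pk_basic k).2.1 t
lemma pk_le_one (k : ℕ) (t : ℝ) : pk k t ≤ 1 := (pk_basic k).2.2 t

lemma pk_int (k : ℕ) (a b : ℝ) : IntervalIntegrable (pk k) volume a b := by
  rw [intervalIntegrable_iff]
  refine Measure.integrableOn_of_bounded (M := 1) (by simp) (pk_meas k).aestronglyMeasurable ?_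
  refine Filter.Eventually.of_forall fun x => ?_
  rw [Real.norm_eq_abs, abs_le]
  exact ⟨by linarith [pk_nonneg k x], pk_le_one k x⟩

lemma pk_even (k : ℕ) (t : ℝ) : pk k (-t) = pk k t := by
  induction k generalizing t with
  | zero =>
    simp only [pk, Set.indicator_apply, Set.mem_Icc]
    congr 1
    apply propext
    constructor <;> rintro ⟨h1, h2⟩ <;> constructor <;> linarith
  | succ k ih =>
    rw [pk_succ, pk_succ]
    have := intervalIntegral.integral_comp_neg (a := t - 1/2) (b := t + 1/2) (pk k)
    simp only [ih] at this
    rw [this]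
    congr 1 <;> ring

/-- comparison of products of interval integrals -/
lemma prod_int_le (f : ℝ → ℝ) (hm : Measurable f) (h0 : ∀ t, 0 ≤ f t) (h1 : ∀ t, f t ≤ 1)
    (a b a' b' s s' l l' : ℝ) (hl : 0 ≤ l) (hl' : 0 ≤ l')
    (h : ∀ ξ ∈ Set.Icc 0 l, ∀ η ∈ Set.Icc 0 l', f (a + ξ) * f (b + η) ≤ f (a' + η) * f (b' + ξ))
    (hs : s = l) (hs' : s' = l') :
    (∫ u in a..(a+s), f u) * (∫ u in b..(b+s'), f u) ≤
    (∫ u in a'..(a'+s'), f u) * (∫ u in b'..(b'+s), f u) := by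
  subst hs hs'
  have sh : ∀ c d : ℝ, ∫ u in c..(c+d), f u = ∫ u in (0:ℝ)..d, f (c + u) := by
    intro c d
    rw [intervalIntegral.integral_comp_add_left]; simp
  have hitg : ∀ a b c, IntervalIntegrable (fun u => f (c + u)) volume a b := by
    intro a b c
    rw [intervalIntegrable_iff]
    refine Measure.integrableOn_of_bounded (M := 1) (by simp)
      (hm.comp (measurable_const_add c)).aestronglyMeasurable ?_
    refine Filter.Eventually.of_forall fun x => ?_
    rw [Real.norm_eq_abs, abs_le]
    exact ⟨by linarith [h0 (c + x)], h1 _⟩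
  rw [sh, sh, sh, sh, mul_comm (∫ u in (0:ℝ)..s', f (a' + u))]
  rw [← intervalIntegral.integral_mul_const, ← intervalIntegral.integral_mul_const]
  refine intervalIntegral.integral_mono_on hl ((hitg _ _ _).mul_const _) ((hitg _ _ _).mul_const _) ?_
  intro ξ hξ
  rw [← intervalIntegral.integral_const_mul, ← intervalIntegral.integral_const_mul]
  refine intervalIntegral.integral_mono_on hl' ((hitg _ _ _).const_mul _) ((hitg _ _ _).const_mul _) ?_
  intro η hη
  rw [mul_comm (f (b' + ξ))]
  exact h ξ hξ η hη

lemma pk_lc (k : ℕ) (x u v : ℝ) (hu : 0 ≤ u) (hv : 0 ≤ v) :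
    pk k x * pk k (x + u + v) ≤ pk k (x + u) * pk k (x + v) := by
  induction k generalizing x u v with
  | zero =>
    simp only [pk, Set.indicator_apply, Set.mem_Icc]
    split_ifs <;> grind
  | succ k ih =>
    have key := prod_int_le (pk k) (pk_meas k) (pk_nonneg k) (pk_le_one k)
    by_cases hu1 : 1 ≤ u
    · -- swap
      have := key (x - 1/2) (x + u + v - 1/2) (x + u - 1/2) (x + v - 1/2) 1 1 1 1
        zero_le_one zero_le_one (by
          intro ξ hξ η hη
          have := ih (x - 1/2 + ξ) (u + η - ξ) v (by linarith [hξ.2, hη.1]) hv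
          convert this using 2 <;> · congr 1; ring) rfl rfl
      simp only [pk_succ]
      convert this using 3 <;> ring
    · push Not at hu1
      have ha := key (x - 1/2 + 1) (x + v - 1/2)
      -- (a)
      have hA : (∫ w in (x - 1/2)..(x - 1/2 + 1), pk k w) * (∫ w in (x + v + 1/2)..(x + v + 1/2 + u), pk k w)
          ≤ (∫ w in (x + 1/2)..(x + 1/2 + u), pk k w) * (∫ w in (x + v - 1/2)..(x + v - 1/2 + 1), pk k w) :=
        key _ _ _ _ _ _ 1 u zero_le_one hu (by
          intro η hη ξ hξ
          have := ih (x - 1/2 + η) (1 + ξ - η) v (by linarith [hξ.1, hη.2]) hv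
          convert this using 2 <;> · congr 1; ring) rfl rfl
      have hB : (∫ w in (x - 1/2)..(x - 1/2 + u), pk k w) * (∫ w in (x + v - 1/2 + u)..(x + v - 1/2 + u + (1 - u)), pk k w)
          ≤ (∫ w in (x - 1/2 + u)..(x - 1/2 + u + (1-u)), pk k w) * (∫ w in (x + v - 1/2)..(x + v - 1/2 + u), pk k w) :=
        key _ _ _ _ _ _ u (1-u) hu (by linarith) (by
          intro ξ hξ η hη
          have := ih (x - 1/2 + ξ) (u + η - ξ) v (by linarith [hξ.2, hη.1]) hv
          convert this using 2 <;> · congr 1; ring) rfl rfl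
      have add : ∀ a b c : ℝ, (∫ w in a..c, pk k w) = (∫ w in a..b, pk k w) + ∫ w in b..c, pk k w :=
        fun a b c => (intervalIntegral.integral_add_adjacent_intervals (pk_int k a b) (pk_int k b c)).symm
      have e1 : x - 1/2 + 1 = x + 1/2 := by ring
      have e2 : x - 1/2 + u + (1-u) = x + 1/2 := by ring
      have e3 : x + v - 1/2 + 1 = x + v + 1/2 := by ring
      have e4 : x + v - 1/2 + u + (1-u) = x + v + 1/2 := by ring
      have e5 : x + u - 1/2 = x - 1/2 + u := by ring
      have e6 : x + u + 1/2 = x + 1/2 + u := by ring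
      have e7 : x + u + v - 1/2 = x + v - 1/2 + u := by ring
      have e8 : x + u + v + 1/2 = x + v + 1/2 + u := by ring
      simp only [pk_succ]
      rw [e1, e3] at hA
      rw [e2, e4] at hB
      rw [e5, e6, e7, e8]
      rw [add (x - 1/2) (x - 1/2 + u) (x + 1/2), add (x + v - 1/2) (x + v - 1/2 + u) (x + v + 1/2)] at hA
      rw [add (x - 1/2) (x - 1/2 + u) (x + 1/2), add (x + v - 1/2) (x + v - 1/2 + u) (x + v + 1/2),
        add (x + v - 1/2 + u) (x + v + 1/2) (x + v + 1/2 + u), add (x - 1/2 + u) (x + 1/2) (x + 1/2 + u)]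
      nlinarith [hA, hB]

lemma pk_le_zero (k : ℕ) (t : ℝ) : pk k t ≤ pk k 0 := by
  wlog ht : 0 ≤ t generalizing t
  · rw [← pk_even]; exact this (-t) (by linarith)
  have := pk_lc k (-t) t t ht ht
  simp only [pk_even, neg_add_cancel, zero_add] at this
  exact abs_le_of_sq_le_sq' (by nlinarith) (pk_nonneg k 0) |>.2

lemma pk_antitone (k : ℕ) : pk (k+1) 0 ≤ pk k 0 := by
  rw [pk_succ]
  calc _ ≤ ∫ u in ((0:ℝ) - 1/2)..(0 + 1/2), pk k 0 :=
        intervalIntegral.integral_mono (by norm_num) (pk_int _ _ _) (by simp) fun u => pk_le_zero k u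
    _ = _ := by simp; norm_num

lemma pk_half (k : ℕ) (t : ℝ) (ht : |t| ≤ 1/2) : pk (k+1) 0 / 2 ≤ pk (k+1) t := by
  wlog h0 : 0 ≤ t generalizing t
  · rw [← pk_even _ t]; exact this (-t) (by rwa [abs_neg]) (by linarith)
  rw [abs_of_nonneg h0] at ht
  have add : ∀ a b c : ℝ, (∫ w in a..c, pk k w) = (∫ w in a..b, pk k w) + ∫ w in b..c, pk k w :=
        fun a b c => (intervalIntegral.integral_add_adjacent_intervals (pk_int k a b) (pk_int k b c)).symm
  have nn : ∀ a b : ℝ, a ≤ b → 0 ≤ ∫ w in a..b, pk k w := fun a b h =>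
    intervalIntegral.integral_nonneg h fun u _ => pk_nonneg k u
  have ev : ∫ w in ((0:ℝ)-1/2)..0, pk k w = ∫ w in (0:ℝ)..(0+1/2), pk k w := by
    have := intervalIntegral.integral_comp_neg (a := (0:ℝ)) (b := 1/2) (pk k)
    simp only [pk_even] at this
    rw [zero_add, this]; norm_num
  rw [pk_succ, pk_succ, add _ 0 (0+1/2), ev, add (t-1/2) 0, add 0 (0+1/2) (t+1/2)]
  have := nn (t-1/2) 0 (by linarith)
  have := nn (0+1/2) (t+1/2) (by linarith)
  linarith

lemma pk_pos (k : ℕ) : 0 < pk k 0 := by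
  induction k with
  | zero => simp [pk, Set.indicator_apply]; norm_num
  | succ k ih =>
    rcases k with _ | k
    · rw [pk_succ]
      have : ∫ u in ((0:ℝ) - 1/2)..(0 + 1/2), pk 0 u = ∫ u in ((0:ℝ) - 1/2)..(0 + 1/2), (1:ℝ) := by
        refine intervalIntegral.integral_congr fun u hu => ?_
        rw [Set.uIcc_of_le (by norm_num)] at hu
        simp only [pk]
        rw [Set.indicator_of_mem]
        exact ⟨by linarith [hu.1], by linarith [hu.2]⟩
      rw [this]; simp
    · rw [pk_succ (k+1)]
      calc 0 < pk (k+1) 0 / 2 := by linarith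
        _ = ∫ u in ((0:ℝ) - 1/2)..(0 + 1/2), pk (k+1) 0 / 2 := by simp; norm_num
        _ ≤ _ := by
          refine intervalIntegral.integral_mono_on (by norm_num) (by simp) (pk_int _ _ _) fun u hu => ?_
          exact pk_half k u (abs_le.2 ⟨by linarith [hu.1], by linarith [hu.2]⟩)

open MeasureTheory ProbabilityTheory Set

lemma pk_step (k : ℕ) (t : ℝ) :
    ∫⁻ v in Set.Icc (-1/2:ℝ) (1/2), ENNReal.ofReal (pk k (t + v)) = ENNReal.ofReal (pk (k+1) t) := by
  have hm : Measurable fun v => pk k (t + v) := (pk_meas k).comp (measurable_const_add t)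
  rw [← ofReal_integral_eq_lintegral_ofReal]
  · rw [integral_Icc_eq_integral_Ioc, ← intervalIntegral.integral_of_le (by norm_num), pk_succ,
      intervalIntegral.integral_comp_add_left]
    congr 3; ring
  · refine Measure.integrableOn_of_bounded (M := 1) (by simp) hm.aestronglyMeasurable ?_
    refine Filter.Eventually.of_forall fun x => ?_
    rw [Real.norm_eq_abs, abs_le]
    exact ⟨by linarith [pk_nonneg k (t+x)], pk_le_one k _⟩
  · exact Filter.Eventually.of_forall fun x => pk_nonneg _ _

/-- uniform measure on the unit interval -/
noncomputable def lam : Measure ℝ := volume.restrict (Set.Icc 0 1)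

instance : IsProbabilityMeasure lam := ⟨by simp [lam]⟩

lemma pk_step_lam (k : ℕ) (t : ℝ) :
    ∫⁻ v, ENNReal.ofReal (pk k (t + (v - 1/2))) ∂lam = ENNReal.ofReal (pk (k+1) t) := by
  rw [← pk_step, lam, ← lintegral_indicator measurableSet_Icc, ← lintegral_indicator measurableSet_Icc,
    ← lintegral_sub_right_eq_self (fun v => Set.indicator (Set.Icc (-1/2:ℝ) (1/2)) _ v) (1/2:ℝ)]
  congr 1; funext v
  simp only [Set.indicator_apply, Set.mem_Icc]
  congr 1
  apply propext
  constructor <;> rintro ⟨h1, h2⟩ <;> constructor <;> linarith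

lemma pk_total (k : ℕ) : ∫⁻ t, ENNReal.ofReal (pk k t) = 1 := by
  induction k with
  | zero =>
    have : ∀ t, ENNReal.ofReal (pk 0 t) = Set.indicator (Set.Icc (-1/2:ℝ) (1/2)) (fun _ => 1) t := by
      intro t; simp only [pk, Set.indicator_apply]; split_ifs <;> simp
    simp_rw [this]
    rw [lintegral_indicator measurableSet_Icc]; simp; norm_num
  | succ k ih =>
    simp_rw [← pk_step]
    rw [lintegral_lintegral_swap]
    · simp_rw [lintegral_add_right_eq_self (fun t => ENNReal.ofReal (pk k t)), ih]
      simp; norm_num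
    · exact (ENNReal.measurable_ofReal.comp ((pk_meas k).comp (by fun_prop))).aemeasurable

lemma pk_conv (k l : ℕ) (t : ℝ) :
    ∫⁻ w, ENNReal.ofReal (pk k (t - w)) * ENNReal.ofReal (pk l w) = ENNReal.ofReal (pk (k+l+1) t) := by
  induction k generalizing t with
  | zero =>
    rw [zero_add, ← pk_step, ← lintegral_indicator measurableSet_Icc,
      ← lintegral_sub_right_eq_self (fun v => Set.indicator _ _ v) t]
    congr 1; funext v
    simp only [pk, Set.indicator_apply, Set.mem_Icc]
    have : (-1/2 ≤ t - v ∧ t - v ≤ 1/2) ↔ (-1/2 ≤ v - t ∧ v - t ≤ 1/2) := by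
      constructor <;> rintro ⟨h1, h2⟩ <;> constructor <;> linarith
    simp only [this]
    split_ifs <;> simp
  | succ k ih =>
    have e : k + 1 + l + 1 = (k + l + 1) + 1 := by ring
    rw [e, ← pk_step (k + l + 1)]
    simp_rw [← ih]
    rw [lintegral_lintegral_swap]
    · congr 1; funext w
      rw [lintegral_mul_const]
      · congr 1
        rw [← pk_step]
        congr 1; funext v; congr 2; ring
      · exact ENNReal.measurable_ofReal.comp ((pk_meas k).comp (by fun_prop))
    · refine Measurable.aemeasurable (Measurable.fun_mul ?_ ?_)
      · exact ENNReal.measurable_ofReal.comp ((pk_meas k).comp (by fun_prop))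
      · exact ENNReal.measurable_ofReal.comp ((pk_meas l).comp (by fun_prop))

lemma pk_integrable (k : ℕ) : Integrable (pk k) := by
  refine ⟨(pk_meas k).aestronglyMeasurable, ?_⟩
  rw [hasFiniteIntegral_iff_ofReal (Filter.Eventually.of_forall (pk_nonneg k)), pk_total]
  simp

lemma pk_integral (k : ℕ) : ∫ t, pk k t = 1 := by
  rw [integral_eq_lintegral_of_nonneg_ae (Filter.Eventually.of_forall (pk_nonneg k))
    (pk_meas k).aestronglyMeasurable, pk_total]; simp

lemma pk_ratio (m : ℕ) : pk m 0 ≤ 2 * pk (2*m) 0 := by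
  have h1 : pk (2*m+1) 0 ≤ pk (2*m) 0 := pk_antitone _
  have h2 : ENNReal.ofReal (pk m 0 / 2) ≤ ENNReal.ofReal (pk (2*m+1) 0) := by
    rw [two_mul, ← pk_conv]
    have : pk m 0 / 2 = ∫ w, pk m 0 * pk m (2*w) := by
      rw [integral_const_mul, Measure.integral_comp_mul_left, pk_integral]
      simp; ring
    rw [this, ofReal_integral_eq_lintegral_ofReal]
    · refine lintegral_mono fun w => ?_
      rw [← ENNReal.ofReal_mul (pk_nonneg _ _)]
      refine ENNReal.ofReal_le_ofReal ?_
      rw [zero_sub, pk_even]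
      wlog hw : 0 ≤ w generalizing w
      · have := this (-w) (by linarith)
        simpa [mul_neg, pk_even] using this
      · have := pk_lc m 0 w w hw hw
        simpa [two_mul] using this
    · exact ((pk_integrable m).comp_mul_left' (by norm_num)).const_mul _
    · exact Filter.Eventually.of_forall fun w => mul_nonneg (pk_nonneg _ _) (pk_nonneg _ _)
  rw [ENNReal.ofReal_le_ofReal_iff (pk_nonneg _ _)] at h2
  linarith

/-- product uniform measure -/
noncomputable def lamN (k : ℕ) : Measure (Fin k → ℝ) := Measure.pi fun _ => lam

instance (k : ℕ) : IsProbabilityMeasure (lamN k) := by unfold lamN; infer_instance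

lemma lamN_succ (k : ℕ) (i : Fin (k+1)) (F : (Fin (k+1) → ℝ) → ENNReal) (hF : Measurable F) :
    ∫⁻ x, F x ∂(lamN (k+1)) = ∫⁻ u, ∫⁻ x, F (i.insertNth u x) ∂(lamN k) ∂lam := by
  have := (measurePreserving_piFinSuccAbove (fun _ : Fin (k+1) => lam) i).symm.lintegral_comp hF
  unfold lamN
  rw [← this, lintegral_prod]
  · rfl
  · exact (hF.comp (MeasurableEquiv.measurable _)).aemeasurable

lemma pk_lamN (k l : ℕ) (t : ℝ) :
    ∫⁻ x, ENNReal.ofReal (pk l (t + ∑ i, (x i - 1/2))) ∂(lamN k) = ENNReal.ofReal (pk (k+l) t) := by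
  induction k generalizing t with
  | zero => simp
  | succ k ih =>
    rw [lamN_succ k 0]
    · have e : k + 1 + l = (k + l) + 1 := by ring
      rw [e, ← pk_step_lam]
      congr 1; funext u
      rw [← ih]
      congr 1; funext x
      congr 2
      rw [Fin.sum_univ_succ]
      simp [add_assoc]
    · exact ENNReal.measurable_ofReal.comp ((pk_meas l).comp (by fun_prop))

open MeasureTheory ProbabilityTheory Set
set_option linter.unusedSimpArgs false

abbrev PD (m : ℕ) := (Fin m → ℝ) × (Fin m → ℝ)

noncomputable def Lm (m : ℕ) : Measure (PD m) := (lamN m).prod (lamN m)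

instance (m : ℕ) : IsProbabilityMeasure (Lm m) := by unfold Lm; infer_instance

noncomputable def dev {m : ℕ} (A : PD m) : ℝ := (∑ i, (A.1 i - 1/2)) + ∑ i, (A.2 i - 1/2)

lemma dev_meas (m : ℕ) : Measurable (dev : PD m → ℝ) := by
  unfold dev; fun_prop

noncomputable def Em (m : ℕ) : Set (PD m) := {A | dev A ∈ Set.Icc (-1/2:ℝ) (1/2)}

lemma Em_meas (m : ℕ) : MeasurableSet (Em m) := (dev_meas m) measurableSet_Icc

noncomputable def nuM (m : ℕ) : Measure (PD m) := ProbabilityTheory.cond (Lm m) (Em m)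

lemma Em_ind (m : ℕ) (A : PD m) :
    (Em m).indicator (fun _ => (1:ENNReal)) A = ENNReal.ofReal (pk 0 (dev A)) := by
  simp only [Em, pk, Set.indicator_apply, Set.mem_ofPred_eq]
  split_ifs <;> simp

lemma ofReal_pk_meas (l : ℕ) {α : Type*} [MeasurableSpace α] {f : α → ℝ} (hf : Measurable f) :
    Measurable fun x => ENNReal.ofReal (pk l (f x)) :=
  ENNReal.measurable_ofReal.comp ((pk_meas l).comp hf)

/-- sections of Em -/
lemma Em_lint (m : ℕ) (F : PD m → ENNReal) (hF : Measurable F) :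
    ∫⁻ A in Em m, F A ∂(Lm m) = ∫⁻ x, ∫⁻ y, F (x, y) * ENNReal.ofReal (pk 0 (dev (x, y))) ∂(lamN m) ∂(lamN m) := by
  rw [← lintegral_indicator (Em_meas m), Lm, lintegral_prod]
  · congr 1; funext x; congr 1; funext y
    rw [← Em_ind]
    classical
    simp only [Set.indicator_apply]
    split_ifs <;> simp
  · exact (hF.indicator (Em_meas m)).aemeasurable

lemma Lm_Em (m : ℕ) : Lm m (Em m) = ENNReal.ofReal (pk (2*m) 0) := by
  have := Em_lint m (fun _ => 1) measurable_const
  simp only [lintegral_const, MeasurableSet.univ, Measure.restrict_apply, Set.univ_inter, one_mul] at this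
  rw [this]
  simp only [dev, pk_lamN]
  have h := pk_lamN m (m + 0) 0
  simp only [zero_add] at h
  rw [h]; congr 2; ring

lemma Lm_Em_ne (m : ℕ) : Lm m (Em m) ≠ 0 := by
  rw [Lm_Em]; simpa using pk_pos (2*m)

instance (m : ℕ) : IsProbabilityMeasure (nuM m) := by
  unfold nuM; exact cond_isProbabilityMeasure (Lm_Em_ne m)

lemma nuM_ac (m : ℕ) : nuM m ≪ Lm m := cond_absolutelyContinuous

lemma nuM_apply (m : ℕ) (S : Set (PD m)) :
    nuM m S = (ENNReal.ofReal (pk (2*m) 0))⁻¹ * Lm m (Em m ∩ S) := by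
  unfold nuM; rw [cond_apply (Em_meas m), Lm_Em]

lemma ofReal_ratio (m : ℕ) : (ENNReal.ofReal (pk (2*m) 0))⁻¹ * ENNReal.ofReal (pk m 0) ≤ 2 := by
  have h := pk_ratio m
  have h0 := pk_pos (2*m)
  rw [← ENNReal.ofReal_inv_of_pos h0, ← ENNReal.ofReal_mul (by positivity)]
  refine ENNReal.ofReal_le_of_le_toReal ?_
  simp only [ENNReal.toReal_ofNat]
  rw [inv_mul_le_iff₀ h0]; linarith

lemma nuM_fst (m : ℕ) (S : Set (Fin m → ℝ)) (hS : MeasurableSet S) :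
    nuM m (Prod.fst ⁻¹' S) ≤ 2 * lamN m S := by
  rw [nuM_apply]
  have h : Lm m (Em m ∩ Prod.fst ⁻¹' S) ≤ ENNReal.ofReal (pk m 0) * lamN m S := by
    rw [Set.inter_comm, ← Measure.restrict_apply (measurable_fst hS),
      ← lintegral_indicator_one (measurable_fst hS), Em_lint]
    · have : ∀ x : Fin m → ℝ, ∫⁻ y, (Prod.fst ⁻¹' S).indicator 1 (x, y) * ENNReal.ofReal (pk 0 (dev (x, y))) ∂(lamN m)
          ≤ ENNReal.ofReal (pk m 0) * S.indicator 1 x := by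
        intro x
        classical
        by_cases hx : x ∈ S
        · simp only [dev, Set.indicator_apply, Set.mem_preimage, hx, if_true, Pi.one_apply, one_mul, mul_one]
          rw [pk_lamN]
          exact ENNReal.ofReal_le_ofReal (pk_le_zero _ _)
        · simp [Set.indicator_apply, hx]
      refine (lintegral_mono this).trans ?_
      rw [lintegral_const_mul _ (measurable_one.indicator hS), lintegral_indicator_one hS]
    · exact measurable_one.indicator (measurable_fst hS)
  calc _ ≤ (ENNReal.ofReal (pk (2*m) 0))⁻¹ * (ENNReal.ofReal (pk m 0) * lamN m S) := by gcongr
    _ = ((ENNReal.ofReal (pk (2*m) 0))⁻¹ * ENNReal.ofReal (pk m 0)) * lamN m S := by ring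
    _ ≤ _ := by gcongr; exact ofReal_ratio m

lemma Lm_swap (m : ℕ) : MeasurePreserving Prod.swap (Lm m) (Lm m) :=
  Measure.measurePreserving_swap

/-- a measure preserving map preserving `dev` preserves the model measure -/
lemma nuM_mp (m : ℕ) (T : PD m → PD m) (hT : MeasurePreserving T (Lm m) (Lm m))
    (hd : ∀ A, dev (T A) = dev A) : MeasurePreserving T (nuM m) (nuM m) := by
  refine ⟨hT.measurable, ?_⟩
  have hpre : T ⁻¹' (Em m) = Em m := by
    ext A; simp [Em, hd]
  unfold nuM ProbabilityTheory.cond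
  rw [Measure.map_smul]
  congr 1
  have := hT.restrict_preimage (Em_meas m)
  rw [hpre] at this
  exact this.map_eq

lemma nuM_swap (m : ℕ) : MeasurePreserving Prod.swap (nuM m) (nuM m) :=
  nuM_mp m _ (Lm_swap m) (fun A => by simp [dev, add_comm])

lemma nuM_map_fst (m : ℕ) : (nuM m).map Prod.fst ≤ (2:ENNReal) • lamN m := by
  refine Measure.le_iff.2 fun S hS => ?_
  rw [Measure.map_apply measurable_fst hS]
  simpa using nuM_fst m S hS

lemma nuM_map_snd (m : ℕ) : (nuM m).map Prod.snd ≤ (2:ENNReal) • lamN m := by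
  have : (Prod.snd : PD m → _) = Prod.fst ∘ Prod.swap := rfl
  rw [this, ← Measure.map_map measurable_fst measurable_swap, (nuM_swap m).map_eq]
  exact nuM_map_fst m

lemma lamN_coord (k l : ℕ) (i : Fin (k+1)) (W : Set ℝ) (hW : MeasurableSet W) (t : ℝ) :
    ∫⁻ x, W.indicator 1 (x i) * ENNReal.ofReal (pk l (t + ∑ j, (x j - 1/2))) ∂(lamN (k+1)) =
    ∫⁻ u, W.indicator 1 u * ENNReal.ofReal (pk (k+l) (t + (u - 1/2))) ∂lam := by
  have hWm : Measurable (W.indicator (1 : ℝ → ENNReal)) := measurable_one.indicator hW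
  rw [lamN_succ k i]
  · congr 1; funext u
    simp only [Fin.insertNth_apply_same]
    rw [lintegral_const_mul _ (ofReal_pk_meas _ (by fun_prop)), ← pk_lamN]
    congr 2; funext x; congr 2
    rw [Fin.sum_univ_succAbove _ i]
    simp [add_assoc]
  · exact (hWm.comp (measurable_pi_apply i)).mul (ofReal_pk_meas _ (by fun_prop))

lemma nuM_rect (m : ℕ) (hm : 2 ≤ m) (i : Fin m) (W V : Set ℝ) (hW : MeasurableSet W) (hV : MeasurableSet V)
    (hWl : lam W = ENNReal.ofReal (1/8)) (hVl : lam V = ENNReal.ofReal (1/8))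
    (h : ∀ u ∈ W, ∀ v ∈ V, |u + v - 1| ≤ 1/2) :
    ENNReal.ofReal (1/128) ≤ nuM m {A | A.1 i ∈ W ∧ A.2 i ∈ V} := by
  obtain ⟨k, rfl⟩ : ∃ k, m = k + 2 := ⟨m - 2, by omega⟩
  have hWm : Measurable (W.indicator (1 : ℝ → ENNReal)) := measurable_one.indicator hW
  have hVm : Measurable (V.indicator (1 : ℝ → ENNReal)) := measurable_one.indicator hV
  rw [nuM_apply]
  have hS : MeasurableSet {A : PD (k+2) | A.1 i ∈ W ∧ A.2 i ∈ V} := by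
    apply MeasurableSet.inter
    · exact ((measurable_pi_apply i).comp measurable_fst) hW
    · exact ((measurable_pi_apply i).comp measurable_snd) hV
  have key : Lm (k+2) (Em (k+2) ∩ {A | A.1 i ∈ W ∧ A.2 i ∈ V}) =
      ∫⁻ v, V.indicator 1 v * ∫⁻ u, W.indicator 1 u *
        ENNReal.ofReal (pk (k+1+(k+1+0)) ((v - 1/2) + (u - 1/2))) ∂lam ∂lam := by
    rw [Set.inter_comm, ← Measure.restrict_apply hS, ← lintegral_indicator_one hS, Em_lint _ _ (measurable_one.indicator hS)]
    have : ∀ x : Fin (k+2) → ℝ, ∫⁻ y, {A : PD (k+2) | A.1 i ∈ W ∧ A.2 i ∈ V}.indicator 1 (x, y)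
          * ENNReal.ofReal (pk 0 (dev (x, y))) ∂(lamN (k+2))
        = W.indicator 1 (x i) * ∫⁻ v, V.indicator 1 v * ENNReal.ofReal (pk (k+1+0) ((∑ j, (x j - 1/2)) + (v - 1/2))) ∂lam := by
      intro x
      rw [← lamN_coord (k+1) 0 i V hV, ← lintegral_const_mul]
      · congr 1; funext y
        classical
        simp only [dev, Set.indicator_apply, Set.mem_ofPred_eq]
        by_cases h1 : x i ∈ W <;> by_cases h2 : y i ∈ V <;>
          simp only [h1, h2, and_true, and_false, if_true, if_false, Pi.one_apply, one_mul, zero_mul, mul_zero, false_and]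
      · exact (hVm.comp (measurable_pi_apply i)).mul (ofReal_pk_meas _ (by fun_prop))
    simp_rw [this]
    have h2 : ∀ x : Fin (k+2) → ℝ, W.indicator 1 (x i) * ∫⁻ v, V.indicator 1 v * ENNReal.ofReal (pk (k+1+0) ((∑ j, (x j - 1/2)) + (v - 1/2))) ∂lam
       = ∫⁻ v, W.indicator 1 (x i) * (V.indicator 1 v * ENNReal.ofReal (pk (k+1+0) ((∑ j, (x j - 1/2)) + (v - 1/2)))) ∂lam := by
      intro x
      rw [lintegral_const_mul]
      exact hVm.mul (ofReal_pk_meas _ (by fun_prop))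
    simp_rw [h2]
    rw [lintegral_lintegral_swap]
    · congr 1; funext v
      rw [← lamN_coord (k+1) (k+1+0) i W hW, ← lintegral_const_mul]
      · congr 1; funext x
        rw [add_comm (v - 1/2)]; ring
      · exact (hWm.comp (measurable_pi_apply i)).mul (ofReal_pk_meas _ (by fun_prop))
    · refine Measurable.aemeasurable (Measurable.fun_mul ?_ (Measurable.fun_mul ?_ ?_))
      · exact hWm.comp ((measurable_pi_apply i).comp measurable_fst)
      · exact hVm.comp measurable_snd
      · exact ofReal_pk_meas _ (by fun_prop)
  rw [key]
  have hp := pk_pos (2*(k+2))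
  have hlow : ∀ u ∈ W, ∀ v ∈ V, pk (2*(k+2)) 0 / 2 ≤ pk (k+1+(k+1+0)) ((v - 1/2) + (u - 1/2)) := by
    intro u hu v hv
    have e : k+1+(k+1+0) = (2*k+1)+1 := by ring
    have e2 : 2*(k+2) = ((2*k+1)+1)+1+1 := by ring
    have h1 : pk (2*(k+2)) 0 ≤ pk ((2*k+1)+1) 0 := by
      rw [e2]; exact (pk_antitone _).trans (pk_antitone _)
    have := pk_half (2*k+1) ((v - 1/2) + (u - 1/2)) (by
      have := h u hu v hv
      rwa [show (v - 1/2) + (u - 1/2) = u + v - 1 by ring])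
    rw [e]; linarith
  have hge : ENNReal.ofReal (pk (2*(k+2)) 0 / 2) * lam W * lam V ≤
    ∫⁻ v, V.indicator 1 v * ∫⁻ u, W.indicator 1 u *
        ENNReal.ofReal (pk (k+1+(k+1+0)) ((v - 1/2) + (u - 1/2))) ∂lam ∂lam := by
    rw [← lintegral_indicator_one hV, ← lintegral_const_mul _ hVm]
    refine lintegral_mono fun v => ?_
    classical
    by_cases hv : v ∈ V
    · simp only [Set.indicator_apply, hv, if_true, Pi.one_apply, one_mul, mul_one]
      rw [← lintegral_indicator_one hW, ← lintegral_const_mul _ hWm]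
      refine lintegral_mono fun u => ?_
      by_cases hu : u ∈ W
      · simpa [Set.indicator_apply, hu] using ENNReal.ofReal_le_ofReal (hlow u hu v hv)
      · simp [Set.indicator_apply, hu]
    · simp [Set.indicator_apply, hv]
  refine le_trans ?_ (mul_le_mul_right hge _)
  rw [hWl, hVl, ← ENNReal.ofReal_inv_of_pos hp, ← ENNReal.ofReal_mul (by positivity), ← ENNReal.ofReal_mul (by positivity), ← ENNReal.ofReal_mul (by positivity)]
  refine ENNReal.ofReal_le_ofReal (le_of_eq ?_)
  field_simp; norm_num

open MeasureTheory ProbabilityTheory Set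
set_option linter.unusedSimpArgs false

noncomputable def lastF {m : ℕ} (A : PD m) : ℝ := 1/2 - dev A

abbrev JJ (m : ℕ) := Fin m ⊕ (Fin m ⊕ Unit)

noncomputable def face {m : ℕ} (A : PD m) : JJ m → ℝ :=
  Sum.elim A.1 (Sum.elim A.2 (fun _ => lastF A))

noncomputable def fs {m : ℕ} (g : ℝ → ℝ) (A : PD m) : ℝ := ∑ j, g (face A j)

lemma fs_expand {m : ℕ} (g : ℝ → ℝ) (A : PD m) :
    fs g A = (∑ i, g (A.1 i)) + ((∑ i, g (A.2 i)) + g (lastF A)) := by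
  simp [fs, face, Fintype.sum_sum_type]

lemma lastF_meas (m : ℕ) : Measurable (lastF : PD m → ℝ) := by
  unfold lastF; exact measurable_const.sub (dev_meas m)

@[fun_prop] lemma face_meas (m : ℕ) (j : JJ m) : Measurable (fun A : PD m => face A j) := by
  rcases j with i | i | i
  · simp only [face, Sum.elim_inl]; fun_prop
  · simp only [face, Sum.elim_inl, Sum.elim_inr]; fun_prop
  · simp only [face, Sum.elim_inl, Sum.elim_inr]; exact lastF_meas m

lemma fs_meas {m : ℕ} (g : ℝ → ℝ) (hg : Measurable g) : Measurable (fun A : PD m => fs g A) := by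
  unfold fs
  exact Finset.measurable_sum _ fun j _ => hg.comp (face_meas m j)

lemma face_sum {m : ℕ} (A : PD m) : ∑ j, face A j = m + 1/2 := by
  have := fs_expand (fun x => x) A
  simp only [fs] at this
  rw [this]
  simp only [lastF, dev, Finset.sum_sub_distrib]
  simp; ring

lemma lam_ae : ∀ᵐ x ∂lam, x ∈ Icc (0:ℝ) 1 := by
  unfold lam; exact ae_restrict_mem measurableSet_Icc

lemma lamN_eval (m : ℕ) (i : Fin m) : MeasurePreserving (fun x : Fin m → ℝ => x i) (lamN m) lam := by
  unfold lamN; exact measurePreserving_eval (fun _ => lam) i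

lemma Lm_eval1 (m : ℕ) (i : Fin m) : MeasurePreserving (fun A : PD m => A.1 i) (Lm m) lam :=
  (lamN_eval m i).comp measurePreserving_fst

lemma Lm_eval2 (m : ℕ) (i : Fin m) : MeasurePreserving (fun A : PD m => A.2 i) (Lm m) lam :=
  (lamN_eval m i).comp measurePreserving_snd

lemma face_ae_mem (m : ℕ) : ∀ᵐ A ∂(nuM m), ∀ j, face A j ∈ Icc (0:ℝ) 1 := by
  rw [ae_all_iff]
  rintro (i | i | i)
  · exact (nuM_ac m).ae_le ((Lm_eval1 m i).quasiMeasurePreserving.ae lam_ae)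
  · exact (nuM_ac m).ae_le ((Lm_eval2 m i).quasiMeasurePreserving.ae lam_ae)
  · have : ∀ᵐ A ∂(nuM m), A ∈ Em m := ae_cond_mem (Em_meas m)
    filter_upwards [this] with A hA
    simp only [Em, Set.mem_ofPred_eq, mem_Icc] at hA
    simp only [face, Sum.elim_inr, lastF, mem_Icc]
    constructor <;> linarith [hA.1, hA.2]

lemma lam_sing (c : ℝ) : lam {c} = 0 := by
  unfold lam
  exact le_antisymm ((Measure.restrict_apply_le _ _).trans (by simp)) bot_le

lemma lamN_hyper (m : ℕ) (c : ℝ) : lamN (m+1) {x | ∑ i, (x i - 1/2) = c} = 0 := by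
  have hm : MeasurableSet {x : Fin (m+1) → ℝ | ∑ i, (x i - 1/2) = c} :=
    measurableSet_eq_fun (by fun_prop) measurable_const
  rw [← lintegral_indicator_one hm, lamN_succ m 0 _ (measurable_one.indicator hm),
    lintegral_lintegral_swap]
  · rw [lintegral_eq_zero_iff']
    swap
    · apply AEMeasurable.lintegral_prod_left
      exact ((measurable_one.indicator hm).comp
        (by fun_prop : Measurable fun p : ℝ × (Fin m → ℝ) => (Fin.insertNth (α := fun _ => ℝ) 0 p.1 p.2 : Fin (m+1) → ℝ))).aemeasurable
    refine Filter.Eventually.of_forall fun x => ?_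
    have : ∀ᵐ u ∂lam, u ≠ c + 1/2 - ∑ i, (x i - 1/2) := by
      rw [ae_iff]; simpa using lam_sing _
    rw [Pi.zero_apply]
    apply lintegral_eq_zero_of_ae_eq_zero
    filter_upwards [this] with u hu
    rw [Set.indicator_of_notMem]
    · rfl
    · simp only [Set.mem_ofPred_eq, Fin.sum_univ_succ]
      intro h
      apply hu
      simp at h ⊢
      linarith
  · exact ((measurable_one.indicator hm).comp
      (by fun_prop : Measurable fun p : ℝ × (Fin m → ℝ) => (Fin.insertNth (α := fun _ => ℝ) 0 p.1 p.2 : Fin (m+1) → ℝ))).aemeasurable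

lemma face_ae_ne (m : ℕ) (c : ℝ) : ∀ᵐ A ∂(nuM (m+1)), ∀ j, face A j ≠ c := by
  rw [ae_all_iff]
  have h0 : ∀ᵐ x ∂lam, x ≠ c := by
    rw [ae_iff]; simpa using lam_sing c
  rintro (i | i | i)
  · exact (nuM_ac _).ae_le ((Lm_eval1 _ i).quasiMeasurePreserving.ae h0)
  · exact (nuM_ac _).ae_le ((Lm_eval2 _ i).quasiMeasurePreserving.ae h0)
  · apply (nuM_ac _).ae_le
    have : ∀ᵐ x ∂(lamN (m+1)), ∀ᵐ y ∂(lamN (m+1)), lastF (x, y) ≠ c := by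
      refine Filter.Eventually.of_forall fun x => ?_
      rw [ae_iff]
      convert lamN_hyper m (1/2 - c - ∑ i, (x i - 1/2)) using 2
      ext y
      simp only [ne_eq, not_not, Set.mem_ofPred_eq, lastF, dev]
      constructor <;> intro h <;> linarith
    have h2 := (Measure.ae_prod_iff_ae_ae (μ := lamN (m+1)) (ν := lamN (m+1)) (p := fun A : PD (m+1) => lastF A ≠ c)
      (by exact (measurableSet_eq_fun (lastF_meas _) measurable_const).compl)).2 this
    exact h2

/-! the flip -/
def Vset : Set (ℝ × ℝ) := Ico (0:ℝ) (1/4) ×ˢ Ico (3/4) 1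
def Vset2 : Set (ℝ × ℝ) := Ico (1/4:ℝ) (1/2) ×ˢ Ico (1/2) (3/4)

open Classical in
noncomputable def tau (p : ℝ × ℝ) : ℝ × ℝ :=
  if p ∈ Vset then (p.1 + 1/4, p.2 - 1/4) else if p ∈ Vset2 then (p.1 - 1/4, p.2 + 1/4) else p

lemma Vset_meas : MeasurableSet Vset := measurableSet_Ico.prod measurableSet_Ico
lemma Vset2_meas : MeasurableSet Vset2 := measurableSet_Ico.prod measurableSet_Ico

lemma tau_meas : Measurable tau := by
  unfold tau
  exact Measurable.ite Vset_meas (by fun_prop) (Measurable.ite Vset2_meas (by fun_prop) measurable_id)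

lemma tau_sum (p : ℝ × ℝ) : (tau p).1 + (tau p).2 = p.1 + p.2 := by
  unfold tau; split_ifs <;> simp

lemma tau_square : tau ⁻¹' (Icc 0 1 ×ˢ Icc 0 1) = Icc 0 1 ×ˢ Icc 0 1 := by
  ext ⟨x, y⟩
  simp only [tau, Vset, Vset2, mem_preimage, mem_prod, mem_Icc, mem_Ico]
  split_ifs with h1 h2
  · simp only; constructor <;> intro h <;> refine ⟨⟨?_,?_⟩,?_,?_⟩ <;> linarith
  · simp only; constructor <;> intro h <;> refine ⟨⟨?_,?_⟩,?_,?_⟩ <;> linarith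
  · rfl

lemma Vset_disj : Disjoint Vset Vset2 := by
  rw [Set.disjoint_left]
  rintro ⟨x, y⟩ h1 h2
  simp only [Vset, Vset2, mem_prod, mem_Ico] at h1 h2
  linarith [h1.1.2, h2.1.1]

lemma tau_vol : MeasurePreserving tau (volume : Measure (ℝ × ℝ)) volume := by
  refine ⟨tau_meas, ?_⟩
  ext S hS
  rw [Measure.map_apply tau_meas hS]
  have key : ∀ R : Set (ℝ×ℝ), MeasurableSet R → volume R = volume (R ∩ Vset) + (volume ((R \ Vset) ∩ Vset2) + volume ((R \ Vset) \ Vset2)) := by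
    intro R hR
    rw [measure_inter_add_sdiff _ Vset2_meas, measure_inter_add_sdiff _ Vset_meas]
  rw [key _ (tau_meas hS), key S hS]
  have e1 : volume (tau ⁻¹' S ∩ Vset) = volume ((S \ Vset) ∩ Vset2) := by
    rw [← measure_preimage_add_right volume ((1/4, -1/4) : ℝ × ℝ) ((S \ Vset) ∩ Vset2)]
    congr 1
    ext ⟨x, y⟩
    by_cases h : (x, y) ∈ Vset
    · have h' : ((x, y) + (1/4, -1/4) : ℝ × ℝ) ∈ Vset2 := by
        simp only [Vset, Vset2, Prod.mk_add_mk, mem_prod, mem_Ico] at h ⊢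
        refine ⟨⟨?_,?_⟩,?_,?_⟩ <;> linarith [h.1.1, h.1.2, h.2.1, h.2.2]
      have h'' : ((x, y) + (1/4, -1/4) : ℝ × ℝ) ∉ Vset := fun h3 => Set.disjoint_left.1 Vset_disj h3 h'
      have h3 : tau (x, y) = (x, y) + (1/4, -1/4) := by
        simp only [tau, h, if_true, Prod.mk_add_mk]; congr 1; ring
      simp only [mem_inter_iff, mem_preimage, mem_sdiff, h, h', h'', h3, and_true, not_false_eq_true]
    · have h' : ((x, y) + (1/4, -1/4) : ℝ × ℝ) ∉ Vset2 := by
        intro h5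
        apply h
        simp only [Vset, Vset2, Prod.mk_add_mk, mem_prod, mem_Ico] at h5 ⊢
        refine ⟨⟨?_,?_⟩,?_,?_⟩ <;> linarith [h5.1.1, h5.1.2, h5.2.1, h5.2.2]
      simp only [mem_inter_iff, mem_preimage, h, h', and_false]
  have e2 : volume ((tau ⁻¹' S \ Vset) ∩ Vset2) = volume (S ∩ Vset) := by
    rw [← measure_preimage_add_right volume ((-1/4, 1/4) : ℝ × ℝ) (S ∩ Vset)]
    congr 1
    ext ⟨x, y⟩
    by_cases h : (x, y) ∈ Vset2
    · have h' : ((x, y) + (-1/4, 1/4) : ℝ × ℝ) ∈ Vset := by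
        simp only [Vset, Vset2, Prod.mk_add_mk, mem_prod, mem_Ico] at h ⊢
        refine ⟨⟨?_,?_⟩,?_,?_⟩ <;> linarith [h.1.1, h.1.2, h.2.1, h.2.2]
      have h'' : (x, y) ∉ Vset := fun h3 => Set.disjoint_left.1 Vset_disj h3 h
      have h3 : tau (x, y) = (x, y) + (-1/4, 1/4) := by
        simp only [tau, h, h'', if_true, if_false, Prod.mk_add_mk]; congr 1; ring
      simp only [mem_inter_iff, mem_preimage, mem_sdiff, h, h', h'', h3, and_true, not_false_eq_true]
    · have h' : ((x, y) + (-1/4, 1/4) : ℝ × ℝ) ∉ Vset := by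
        intro h5
        apply h
        simp only [Vset, Vset2, Prod.mk_add_mk, mem_prod, mem_Ico] at h5 ⊢
        refine ⟨⟨?_,?_⟩,?_,?_⟩ <;> linarith [h5.1.1, h5.1.2, h5.2.1, h5.2.2]
      simp only [mem_inter_iff, mem_preimage, h, h', and_false]
  have e3 : (tau ⁻¹' S \ Vset) \ Vset2 = (S \ Vset) \ Vset2 := by
    ext p
    simp only [mem_sdiff, mem_preimage]
    constructor <;> rintro ⟨⟨h1, h2⟩, h3⟩ <;> refine ⟨⟨?_, h2⟩, h3⟩ <;> simpa [tau, h2, h3] using h1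
  rw [e1, e2, e3]; ring

lemma tau_lam : MeasurePreserving tau (lam.prod lam) (lam.prod lam) := by
  have : lam.prod lam = (volume : Measure (ℝ×ℝ)).restrict (Icc 0 1 ×ˢ Icc 0 1) := by
    unfold lam; rw [Measure.prod_restrict]; rfl
  rw [this]
  have h := tau_vol.restrict_preimage (s := Icc 0 1 ×ˢ Icc 0 1) (measurableSet_Icc.prod measurableSet_Icc)
  rwa [tau_square] at h

noncomputable def tb (b : Bool) (p : ℝ × ℝ) : ℝ × ℝ := if b then tau p else p

lemma tb_lam (b : Bool) : MeasurePreserving (tb b) (lam.prod lam) (lam.prod lam) := by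
  cases b
  · exact MeasurePreserving.id _
  · exact tau_lam

lemma tb_sum (b : Bool) (p : ℝ × ℝ) : (tb b p).1 + (tb b p).2 = p.1 + p.2 := by
  cases b
  · rfl
  · exact tau_sum p

noncomputable def Tf {m : ℕ} (e : Fin m → Bool) (A : PD m) : PD m :=
  (fun i => (tb (e i) (A.1 i, A.2 i)).1, fun i => (tb (e i) (A.1 i, A.2 i)).2)

lemma Tf_dev {m : ℕ} (e : Fin m → Bool) (A : PD m) : dev (Tf e A) = dev A := by
  simp only [dev, Tf, ← Finset.sum_add_distrib]
  refine Finset.sum_congr rfl fun i _ => ?_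
  linarith [tb_sum (e i) (A.1 i, A.2 i)]

lemma Tf_Lm {m : ℕ} (e : Fin m → Bool) : MeasurePreserving (Tf e) (Lm m) (Lm m) := by
  have h1 := measurePreserving_arrowProdEquivProdArrow ℝ ℝ (Fin m) (fun _ => lam) (fun _ => lam)
  have h2 := measurePreserving_pi (fun _ : Fin m => lam.prod lam) (fun _ => lam.prod lam)
    (f := fun i => tb (e i)) (fun i => tb_lam (e i))
  exact (h1.comp h2).comp (h1.symm)

lemma Tf_nu {m : ℕ} (e : Fin m → Bool) : MeasurePreserving (Tf e) (nuM m) (nuM m) :=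
  nuM_mp m _ (Tf_Lm e) (Tf_dev e)

open MeasureTheory ProbabilityTheory Set
set_option linter.unusedSimpArgs false

noncomputable def sb (b : Bool) : ℝ := if b then -1 else 1

lemma sb_not (b : Bool) : sb (!b) = - sb b := by cases b <;> simp [sb]

lemma sum_cons (m : ℕ) (F : (Fin (m+1) → Bool) → ℝ) :
    ∑ e, F e = ∑ e : Fin m → Bool, (F (Fin.cons true e) + F (Fin.cons false e)) := by
  rw [← (Fin.consEquiv (fun _ : Fin (m+1) => Bool)).sum_comp, Fintype.sum_prod_type]
  simp [Fin.consEquiv, Finset.sum_add_distrib]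

lemma rad_moments (m : ℕ) (D : Fin m → ℝ) :
    (∑ e : Fin m → Bool, (∑ i, sb (e i) * D i)^2 = 2^m * ∑ i, D i^2) ∧
    (∑ e : Fin m → Bool, (∑ i, sb (e i) * D i)^4 ≤ 3 * 2^m * (∑ i, D i^2)^2) := by
  induction m with
  | zero => simp
  | succ m ih =>
    obtain ⟨h2, h4⟩ := ih (fun i => D i.succ)
    simp only [sum_cons, Fin.sum_univ_succ, Fin.cons_zero, Fin.cons_succ]
    set d := D 0
    set S := ∑ i : Fin m, D i.succ ^ 2
    have hc : (∑ _e : Fin m → Bool, (1:ℝ)) = 2^m := by simp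
    constructor
    · have : ∀ e : Fin m → Bool, (sb true * d + ∑ i, sb (e i) * D i.succ)^2 + (sb false * d + ∑ i, sb (e i) * D i.succ)^2
          = 2 * (∑ i, sb (e i) * D i.succ)^2 + 2 * d^2 * 1 := by
        intro e; simp [sb]; ring
      simp only [this, Finset.sum_add_distrib, ← Finset.mul_sum, h2, hc]
      ring
    · have : ∀ e : Fin m → Bool, (sb true * d + ∑ i, sb (e i) * D i.succ)^4 + (sb false * d + ∑ i, sb (e i) * D i.succ)^4
          = 2 * (∑ i, sb (e i) * D i.succ)^4 + 12 * d^2 * (∑ i, sb (e i) * D i.succ)^2 + 2 * d^4 * 1 := by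
        intro e; simp [sb]; ring
      simp only [this, Finset.sum_add_distrib, ← Finset.mul_sum, h2, hc]
      have : 0 ≤ (2:ℝ)^m * d^4 := by positivity
      have e : (2:ℝ)^(m+1) = 2*2^m := by ring
      rw [e]
      nlinarith

lemma khin (m : ℕ) (c : ℝ) (D : Fin m → ℝ) :
    2^m * ∑ i, |D i| ≤ √(3*m) * ∑ e : Fin m → Bool, |c + ∑ i, sb (e i) * D i| := by
  obtain ⟨h2, h4⟩ := rad_moments m D
  set Y : (Fin m → Bool) → ℝ := fun e => ∑ i, sb (e i) * D i with hY
  have hsym : ∑ e, |Y e| ≤ ∑ e, |c + Y e| := by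
    have h : ∑ e, |c + Y e| = ∑ e, |c - Y e| := by
      let φ : (Fin m → Bool) ≃ (Fin m → Bool) := Equiv.piCongrRight fun _ => Equiv.boolNot
      rw [← φ.sum_comp]
      refine Finset.sum_congr rfl fun e _ => ?_
      congr 1
      have : Y (φ e) = - Y e := by
        simp only [hY, φ, Equiv.piCongrRight_apply, Pi.map_apply, Equiv.boolNot_apply, sb_not, neg_mul, Finset.sum_neg_distrib]
      rw [this]; ring
    have h3 : ∑ e, 2 * |Y e| ≤ ∑ e, (|c + Y e| + |c - Y e|) := by
      refine Finset.sum_le_sum fun e _ => ?_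
      have := abs_sub (c + Y e) (c - Y e)
      have e2 : c + Y e - (c - Y e) = 2 * Y e := by ring
      rw [e2, abs_mul, abs_two] at this
      exact this
    rw [Finset.sum_add_distrib, ← h, ← Finset.mul_sum] at h3
    linarith
  set S := ∑ i, D i^2 with hS
  have hS0 : 0 ≤ S := Finset.sum_nonneg fun i _ => sq_nonneg _
  have hcs : (∑ i, |D i|)^2 ≤ m * S := by
    have := sq_sum_le_card_mul_sum_sq (s := Finset.univ) (f := fun i => |D i|)
    simpa [hS, sq_abs] using this
  set s := √(3*S) with hs
  have hs2 : s^2 = 3*S := Real.sq_sqrt (by positivity)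
  have hs0 : 0 ≤ s := Real.sqrt_nonneg _
  have hY1 : 2^m * (s/3) ≤ ∑ e, |Y e| := by
    rcases hs0.eq_or_lt with h | h
    · rw [← h]; simp; exact Finset.sum_nonneg fun i _ => abs_nonneg _
    · have h5 : ∀ e, 3 * s^2 * (Y e)^2 - (Y e)^4 ≤ 2 * s^3 * |Y e| := by
        intro e
        rw [← sq_abs (Y e), ← (by rw [← abs_pow]; exact abs_of_nonneg (by positivity) : |Y e|^4 = (Y e)^4)]
        have := abs_nonneg (Y e)
        set y := |Y e|
        nlinarith [mul_nonneg (mul_nonneg this (sq_nonneg (y - s))) (by linarith : (0:ℝ) ≤ y + 2*s)]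
      have h6 := Finset.sum_le_sum (s := Finset.univ) fun e _ => h5 e
      rw [Finset.sum_sub_distrib, ← Finset.mul_sum, ← Finset.mul_sum, h2] at h6
      have h7 : 2 * s^3 * (2^m * (s/3)) ≤ 2 * s^3 * ∑ e, |Y e| := by
        refine le_trans (le_of_eq ?_) (h6.trans' (sub_le_sub_left h4 _))
        have : S = s^2/3 := by linarith
        rw [this]; ring
      exact le_of_mul_le_mul_left h7 (by positivity)
  have hD : ∑ i, |D i| ≤ √(3*m) * (s/3) := by
    apply le_of_sq_le_sq _ (by positivity)
    rw [mul_pow, Real.sq_sqrt (by positivity), div_pow, hs2]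
    nlinarith
  calc 2^m * ∑ i, |D i| ≤ 2^m * (√(3*m) * (s/3)) := by gcongr
    _ = √(3*m) * (2^m * (s/3)) := by ring
    _ ≤ _ := by gcongr; exact hY1.trans hsym

lemma bint {α : Type*} [MeasurableSpace α] {μ : Measure α} [IsFiniteMeasure μ] {f : α → ℝ} (hf : Measurable f)
    {M : ℝ} (h : ∀ x, |f x| ≤ M) : Integrable f μ :=
  Integrable.of_bound hf.aestronglyMeasurable M (Filter.Eventually.of_forall fun x => by simpa using h x)

lemma mp_int {α β : Type*} [MeasurableSpace α] [MeasurableSpace β] {μ : Measure α} {ν : Measure β} {T : α → β}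
    (hT : MeasurePreserving T μ ν) {f : β → ℝ} (hf : AEStronglyMeasurable f ν) :
    ∫ x, f (T x) ∂μ = ∫ y, f y ∂ν := by
  rw [← hT.map_eq] at hf ⊢
  rw [integral_map hT.measurable.aemeasurable hf]

lemma bint2 {α β : Type*} [MeasurableSpace α] [MeasurableSpace β] {μ : Measure α} {ν : Measure β}
    [IsFiniteMeasure μ] [IsFiniteMeasure ν] {F : α → β → ℝ} (hF : Measurable fun p : α × β => F p.1 p.2)
    {M : ℝ} (h : ∀ x y, |F x y| ≤ M) : Integrable (fun x => ∫ y, F x y ∂ν) μ :=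
  (bint (μ := μ.prod ν) hF (fun p => h p.1 p.2)).integral_prod_left

lemma bswap {α β : Type*} [MeasurableSpace α] [MeasurableSpace β] {μ : Measure α} {ν : Measure β}
    [IsFiniteMeasure μ] [IsFiniteMeasure ν] {F : α → β → ℝ} (hF : Measurable fun p : α × β => F p.1 p.2)
    {M : ℝ} (h : ∀ x y, |F x y| ≤ M) : ∫ x, ∫ y, F x y ∂ν ∂μ = ∫ y, ∫ x, F x y ∂μ ∂ν :=
  integral_integral_swap (bint (μ := μ.prod ν) hF (fun p => h p.1 p.2))

lemma fs_bound {m : ℕ} {g : ℝ → ℝ} {M : ℝ} (h : ∀ x, |g x| ≤ M) (A : PD m) : |fs g A| ≤ (2*m+1) * M := by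
  unfold fs
  refine (Finset.abs_sum_le_sum_abs _ _).trans ?_
  refine (Finset.sum_le_sum fun j _ => h _).trans (le_of_eq ?_)
  have hc : Fintype.card (JJ m) = 2*m+1 := by simp; ring
  rw [Finset.sum_const, Finset.card_univ, hc, nsmul_eq_mul]
  push_cast; rfl

noncomputable def dd (g : ℝ → ℝ) (p : ℝ × ℝ) : ℝ :=
  (g p.1 + g p.2 - g (tau p).1 - g (tau p).2) / 2

lemma dd_meas {g : ℝ → ℝ} (hg : Measurable g) : Measurable (dd g) := by
  have := tau_meas
  unfold dd; fun_prop

lemma dd_bound {g : ℝ → ℝ} {M : ℝ} (h : ∀ x, |g x| ≤ M) (p : ℝ × ℝ) : |dd g p| ≤ 2 * M := by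
  unfold dd
  have h1 := abs_le.1 (h p.1)
  have h2 := abs_le.1 (h p.2)
  have h3 := abs_le.1 (h (tau p).1)
  have h4 := abs_le.1 (h (tau p).2)
  rw [abs_le]; constructor <;> linarith

lemma fs_Tf {m : ℕ} (g : ℝ → ℝ) (A : PD m) : ∃ c, ∀ e, fs g (Tf e A) = c + ∑ i, sb (e i) * dd g (A.1 i, A.2 i) := by
  refine ⟨g (lastF A) + ∑ i, (g (A.1 i) + g (A.2 i) + g (tau (A.1 i, A.2 i)).1 + g (tau (A.1 i, A.2 i)).2)/2, fun e => ?_⟩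
  have : lastF (Tf e A) = lastF A := by simp only [lastF, Tf_dev]
  rw [fs_expand, this, ← add_assoc, ← Finset.sum_add_distrib, add_comm, add_assoc, ← Finset.sum_add_distrib]
  congr 1
  refine Finset.sum_congr rfl fun i _ => ?_
  simp only [Tf, tb]
  cases e i <;> simp [sb, dd] <;> ring

lemma flip_le {m : ℕ} {g : ℝ → ℝ} (hg : Measurable g) {M : ℝ} (h : ∀ x, |g x| ≤ M) :
    ∑ i : Fin m, ∫ A, |dd g (A.1 i, A.2 i)| ∂(nuM m) ≤ √(3*m) * ∫ A, |fs g A| ∂(nuM m) := by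
  have hfi : Integrable (fun A : PD m => |fs g A|) (nuM m) := (bint (fs_meas g hg) (fs_bound h)).abs
  have hdi : ∀ i : Fin m, Integrable (fun A : PD m => |dd g (A.1 i, A.2 i)|) (nuM m) := fun i =>
    (bint ((dd_meas hg).comp (by fun_prop)) (fun A => dd_bound h _)).abs
  have h1 : ∀ e : Fin m → Bool, ∫ A, |fs g (Tf e A)| ∂(nuM m) = ∫ A, |fs g A| ∂(nuM m) := by
    intro e
    exact mp_int (Tf_nu e) (f := fun A => |fs g A|) hfi.aestronglyMeasurable
  have hei : ∀ e : Fin m → Bool, Integrable (fun A : PD m => |fs g (Tf e A)|) (nuM m) := fun e =>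
    (bint ((fs_meas g hg).comp (Tf_nu e).measurable) (fun A => fs_bound h _)).abs
  have h2 : ∫ A, 2^m * ∑ i : Fin m, |dd g (A.1 i, A.2 i)| ∂(nuM m)
      ≤ ∫ A, √(3*m) * ∑ e : Fin m → Bool, |fs g (Tf e A)| ∂(nuM m) := by
    refine integral_mono ?_ ?_ fun A => ?_
    · exact (integrable_finsetSum _ fun i _ => hdi i).const_mul _
    · exact (integrable_finsetSum _ fun e _ => hei e).const_mul _
    · obtain ⟨c, hc⟩ := fs_Tf g A
      simp only [hc]
      exact khin m c _
  rw [integral_const_mul, integral_const_mul, integral_finsetSum _ fun i _ => hdi i,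
    integral_finsetSum _ fun e _ => hei e] at h2
  simp only [h1, Finset.sum_const] at h2
  rw [Finset.card_univ, Fintype.card_fun, Fintype.card_bool, Fintype.card_fin, nsmul_eq_mul] at h2
  push_cast at h2
  have : (0:ℝ) < 2^m := by positivity
  refine le_of_mul_le_mul_left (h2.trans (le_of_eq ?_)) this
  ring

noncomputable def sg (a b : ℝ) : ℝ := (if b < a then (1 : ℝ) else 0) - (if a < b then (1 : ℝ) else 0)

lemma sg_meas : Measurable (fun p : ℝ × ℝ => sg p.1 p.2) := by
  unfold sg
  exact (Measurable.ite (measurableSet_lt measurable_snd measurable_fst) measurable_const measurable_const).sub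
    (Measurable.ite (measurableSet_lt measurable_fst measurable_snd) measurable_const measurable_const)

lemma sg_bound (a b : ℝ) : |sg a b| ≤ 1 := by
  unfold sg; split_ifs <;> norm_num

noncomputable def Xf {m : ℕ} (A B : PD m) : ℝ := fs (fun a => fs (fun b => sg a b) B) A

lemma fs_meas2 {m : ℕ} {α : Type*} [MeasurableSpace α] {f : α → ℝ → ℝ} (hf : Measurable fun p : α × ℝ => f p.1 p.2)
    {B : α → PD m} (hB : Measurable B) : Measurable fun x => fs (f x) (B x) := by
  unfold fs
  refine Finset.measurable_sum _ fun j _ => ?_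
  exact hf.comp (measurable_id.prodMk ((face_meas m j).comp hB))

lemma Xf_meas (m : ℕ) : Measurable (fun p : PD m × PD m => Xf p.1 p.2) := by
  have h1 : Measurable (fun q : ((PD m × PD m) × ℝ) × ℝ => sg q.1.2 q.2) :=
    sg_meas.comp ((measurable_snd.comp measurable_fst).prodMk measurable_snd)
  have h2 := fs_meas2 (α := (PD m × PD m) × ℝ) (f := fun q b => sg q.2 b) h1
    (B := fun q => q.1.2) (measurable_snd.comp measurable_fst)
  exact fs_meas2 (α := PD m × PD m) (f := fun p a => fs (fun b => sg a b) p.2) h2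
    (B := fun q => q.1) measurable_fst

lemma Xf_bound {m : ℕ} (A B : PD m) : |Xf A B| ≤ (2*m+1)*((2*m+1)*1) :=
  fs_bound (fun a => fs_bound (fun b => sg_bound a b) B) A

lemma dd_fs {m : ℕ} (k : ℝ → ℝ → ℝ) (B : PD m) (p : ℝ × ℝ) :
    dd (fun a => fs (fun b => k a b) B) p = fs (fun b => dd (fun a => k a b) p) B := by
  simp only [dd, fs, ← Finset.sum_add_distrib, ← Finset.sum_sub_distrib, Finset.sum_div]

lemma dd_meas2 {α : Type*} [MeasurableSpace α] {f : α → ℝ → ℝ} (hf : Measurable fun p : α × ℝ => f p.1 p.2)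
    {B : α → ℝ × ℝ} (hB : Measurable B) : Measurable fun x => dd (f x) (B x) := by
  unfold dd
  have h : ∀ u : α → ℝ, Measurable u → Measurable fun x => f x (u x) := fun u hu =>
    hf.comp (measurable_id.prodMk hu)
  have h1 := h (fun x => (B x).1) hB.fst
  have h2 := h (fun x => (B x).2) hB.snd
  have h3 := h (fun x => (tau (B x)).1) (tau_meas.comp hB).fst
  have h4 := h (fun x => (tau (B x)).2) (tau_meas.comp hB).snd
  exact (((h1.add h2).sub h3).sub h4).div_const 2

lemma dd_val (a a' b b' : ℝ) (ha : a ∈ Ico (0:ℝ) (1/8)) (ha' : a' ∈ Ico (3/4:ℝ) (7/8))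
    (hb : b ∈ Ico (1/8:ℝ) (1/4)) (hb' : b' ∈ Ico (7/8:ℝ) 1) :
    dd (fun y => dd (fun x => sg x y) (a, a')) (b, b') = -1 := by
  obtain ⟨h1, h2⟩ := ha
  obtain ⟨h3, h4⟩ := ha'
  obtain ⟨h5, h6⟩ := hb
  obtain ⟨h7, h8⟩ := hb'
  have hA : (a, a') ∈ Vset := by
    simp only [Vset, mem_prod, mem_Ico]; refine ⟨⟨?_,?_⟩,?_,?_⟩ <;> linarith
  have hB : (b, b') ∈ Vset := by
    simp only [Vset, mem_prod, mem_Ico]; refine ⟨⟨?_,?_⟩,?_,?_⟩ <;> linarith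
  have lt : ∀ x y : ℝ, x < y → sg x y = -1 := fun x y h => by simp [sg, h, h.le, not_lt.2 h.le]
  have gt : ∀ x y : ℝ, y < x → sg x y = 1 := fun x y h => by simp [sg, h, h.le, not_lt.2 h.le]
  simp only [dd, tau, hA, hB, if_true]
  rw [lt a b (by linarith), gt a' b (by linarith), gt (a+1/4) b (by linarith), gt (a'-1/4) b (by linarith),
    lt a b' (by linarith), lt a' b' (by linarith), lt (a+1/4) b' (by linarith), lt (a'-1/4) b' (by linarith),
    lt a (b+1/4) (by linarith), gt a' (b+1/4) (by linarith), lt (a+1/4) (b+1/4) (by linarith), gt (a'-1/4) (b+1/4) (by linarith),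
    lt a (b'-1/4) (by linarith), gt a' (b'-1/4) (by linarith), lt (a+1/4) (b'-1/4) (by linarith), lt (a'-1/4) (b'-1/4) (by linarith)]
  norm_num

open MeasureTheory ProbabilityTheory Set
set_option linter.unusedSimpArgs false

lemma meas2 {α β γ δ : Type*} [MeasurableSpace α] [MeasurableSpace β] [MeasurableSpace γ] [MeasurableSpace δ]
    {f : α → β → γ} (hf : Measurable fun p : α × β => f p.1 p.2) {u : δ → α} {v : δ → β}
    (hu : Measurable u) (hv : Measurable v) : Measurable fun x => f (u x) (v x) :=
  hf.comp (hu.prodMk hv)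

noncomputable def pr {m : ℕ} (i : Fin m) (A : PD m) : ℝ × ℝ := (A.1 i, A.2 i)
@[fun_prop] lemma pr_meas {m : ℕ} (i : Fin m) : Measurable (fun A : PD m => pr i A) := by unfold pr; fun_prop

noncomputable def h1f (p : ℝ × ℝ) (b : ℝ) : ℝ := dd (fun a => sg a b) p
lemma h1f_meas : Measurable fun q : (ℝ × ℝ) × ℝ => h1f q.1 q.2 := by
  have h : Measurable fun p : ((ℝ×ℝ)×ℝ)×ℝ => sg p.2 p.1.2 :=
    meas2 sg_meas (u := fun p : ((ℝ×ℝ)×ℝ)×ℝ => p.2) (v := fun p => p.1.2) (by fun_prop) (by fun_prop)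
  exact dd_meas2 (α := (ℝ×ℝ)×ℝ) (f := fun q a => sg a q.2) h (B := fun q => q.1) measurable_fst
lemma h1f_bound (p : ℝ × ℝ) (b : ℝ) : |h1f p b| ≤ 2 * 1 := dd_bound (fun a => sg_bound a b) p

noncomputable def h2f (p q : ℝ × ℝ) : ℝ := dd (h1f p) q
lemma h2f_meas : Measurable fun q : (ℝ × ℝ) × (ℝ × ℝ) => h2f q.1 q.2 := by
  have h : Measurable fun p : ((ℝ×ℝ)×(ℝ×ℝ))×ℝ => h1f p.1.1 p.2 :=
    meas2 h1f_meas (u := fun p : ((ℝ×ℝ)×(ℝ×ℝ))×ℝ => p.1.1) (v := fun p => p.2) (by fun_prop) (by fun_prop)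
  exact dd_meas2 (α := (ℝ×ℝ)×(ℝ×ℝ)) (f := fun q a => h1f q.1 a) h (B := fun q => q.2) measurable_snd
lemma h2f_bound (p q : ℝ × ℝ) : |h2f p q| ≤ 2 * (2 * 1) := dd_bound (h1f_bound p) q

lemma h2_lower (m : ℕ) (hm : 2 ≤ m) (i j : Fin m) :
    (1/128:ℝ) * (1/128) ≤ ∫ A, ∫ B, |h2f (pr i A) (pr j B)| ∂(nuM m) ∂(nuM m) := by
  set S1 : Set (PD m) := {A | A.1 i ∈ Ico (0:ℝ) (1/8) ∧ A.2 i ∈ Ico (3/4:ℝ) (7/8)} with hS1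
  set S2 : Set (PD m) := {A | A.1 j ∈ Ico (1/8:ℝ) (1/4) ∧ A.2 j ∈ Ico (7/8:ℝ) 1} with hS2
  have lamI : ∀ x y : ℝ, 0 ≤ x → y ≤ 1 → y - x = 1/8 → lam (Ico x y) = ENNReal.ofReal (1/8) := by
    intro x y h1 h2 h3
    rw [lam, Measure.restrict_apply measurableSet_Ico, inter_eq_left.2, Real.volume_Ico, h3]
    intro z hz; exact ⟨h1.trans hz.1, hz.2.le.trans h2⟩
  have n1 : (1/128:ℝ) ≤ (nuM m).real S1 := by
    rw [measureReal_def, ← ENNReal.ofReal_le_iff_le_toReal (measure_ne_top _ _)]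
    refine nuM_rect m hm i _ _ measurableSet_Ico measurableSet_Ico (lamI _ _ ?_ ?_ ?_) (lamI _ _ ?_ ?_ ?_) ?_ <;> norm_num
    intro u h1 h2 v h3 h4
    rw [abs_le]; constructor <;> linarith
  have n2 : (1/128:ℝ) ≤ (nuM m).real S2 := by
    rw [measureReal_def, ← ENNReal.ofReal_le_iff_le_toReal (measure_ne_top _ _)]
    refine nuM_rect m hm j _ _ measurableSet_Ico measurableSet_Ico (lamI _ _ ?_ ?_ ?_) (lamI _ _ ?_ ?_ ?_) ?_ <;> norm_num
    intro u h1 h2 v h3 h4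
    rw [abs_le]; constructor <;> linarith
  have m1 : MeasurableSet S1 := ((by fun_prop : Measurable fun A : PD m => A.1 i) measurableSet_Ico).inter
    ((by fun_prop : Measurable fun A : PD m => A.2 i) measurableSet_Ico)
  have m2 : MeasurableSet S2 := ((by fun_prop : Measurable fun A : PD m => A.1 j) measurableSet_Ico).inter
    ((by fun_prop : Measurable fun A : PD m => A.2 j) measurableSet_Ico)
  have i2 : Integrable (S2.indicator (fun _ => (1:ℝ))) (nuM m) := (integrable_const 1).indicator m2
  have hjm : Measurable fun p : PD m × PD m => |h2f (pr i p.1) (pr j p.2)| :=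
    (meas2 h2f_meas (u := fun p : PD m × PD m => pr i p.1) (v := fun p => pr j p.2) (by fun_prop) (by fun_prop)).abs
  have key : ∀ A, S1.indicator (fun _ => (nuM m).real S2) A ≤ ∫ B, |h2f (pr i A) (pr j B)| ∂(nuM m) := by
    intro A
    by_cases hA : A ∈ S1
    · rw [indicator_of_mem hA]
      have : (nuM m).real S2 = ∫ B, S2.indicator (fun _ => (1:ℝ)) B ∂(nuM m) := by
        rw [integral_indicator m2]; simp
      rw [this]
      refine integral_mono i2 ?_ fun B => ?_
      · exact bint (meas2 h2f_meas (u := fun _ : PD m => pr i A) (v := fun B => pr j B) (by fun_prop) (by fun_prop)).abs (M := 4)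
          (fun B => by rw [abs_abs]; linarith [h2f_bound (pr i A) (pr j B)])
      · by_cases hB : B ∈ S2
        · rw [indicator_of_mem hB]
          have := dd_val _ _ _ _ hA.1 hA.2 hB.1 hB.2
          have h3 : h2f (pr i A) (pr j B) = -1 := this
          simp [h3]
        · rw [indicator_of_notMem hB]; exact abs_nonneg _
    · rw [indicator_of_notMem hA]; exact integral_nonneg fun _ => abs_nonneg _
  calc (1/128:ℝ) * (1/128) ≤ (nuM m).real S1 * (nuM m).real S2 := by gcongr
    _ = ∫ A, S1.indicator (fun _ => (nuM m).real S2) A ∂(nuM m) := by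
      rw [integral_indicator m1]; simp
    _ ≤ _ := by
      refine integral_mono ((integrable_const _).indicator m1) ?_ key
      exact bint2 (M := 4) hjm (fun A B => by rw [abs_abs]; linarith [h2f_bound (pr i A) (pr j B)])


open MeasureTheory ProbabilityTheory Set
set_option linter.unusedSimpArgs false

lemma gB_meas {m : ℕ} (B : PD m) : Measurable fun a => fs (fun b => sg a b) B :=
    fs_meas2 (α := ℝ) (f := fun a b => sg a b) sg_meas (B := fun _ => B) measurable_const

noncomputable def Hh {m : ℕ} (i : Fin m) (A B : PD m) : ℝ := |fs (h1f (pr i A)) B|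
noncomputable def H2 {m : ℕ} (i j : Fin m) (A B : PD m) : ℝ := |h2f (pr i A) (pr j B)|
noncomputable def Xa {m : ℕ} (A B : PD m) : ℝ := |Xf A B|

lemma Hh_meas {m : ℕ} (i : Fin m) : Measurable fun p : PD m × PD m => Hh i p.1 p.2 := by
  have h1 : Measurable fun p : (PD m × PD m) × ℝ => h1f (pr i p.1.1) p.2 :=
    meas2 h1f_meas (u := fun p : (PD m × PD m) × ℝ => pr i p.1.1) (v := fun p => p.2) (by fun_prop) (by fun_prop)
  have h2 : Measurable fun p : PD m × PD m => fs (h1f (pr i p.1)) p.2 :=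
    fs_meas2 (α := PD m × PD m) (f := fun p b => h1f (pr i p.1) b) h1 (B := fun p => p.2) measurable_snd
  exact h2.abs

lemma Hh_bound {m : ℕ} (i : Fin m) (A B : PD m) : |Hh i A B| ≤ (2*m+1)*(2*1) := by
  unfold Hh
  rw [abs_abs]; exact fs_bound (h1f_bound _) B

lemma H2_meas {m : ℕ} (i j : Fin m) : Measurable fun p : PD m × PD m => H2 i j p.1 p.2 :=
    (meas2 h2f_meas (u := fun p : PD m × PD m => pr i p.1) (v := fun p => pr j p.2) (by fun_prop) (by fun_prop)).abs

lemma H2_bound {m : ℕ} (i j : Fin m) (A B : PD m) : |H2 i j A B| ≤ 2*(2*1) := by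
  unfold H2
  rw [abs_abs]; exact h2f_bound _ _

lemma Xa_meas (m : ℕ) : Measurable fun p : PD m × PD m => Xa p.1 p.2 := (Xf_meas m).abs

lemma Xa_bound {m : ℕ} (A B : PD m) : |Xa A B| ≤ (2*m+1)*((2*m+1)*1) := by
  unfold Xa
  rw [abs_abs]; exact Xf_bound A B

lemma EXs1 {m : ℕ} (B : PD m) : ∑ i : Fin m, ∫ A, Hh i A B ∂(nuM m) ≤ √(3*m) * ∫ A, Xa A B ∂(nuM m) := by
  have := flip_le (m := m) (gB_meas B) (fun a => fs_bound (fun b => sg_bound a b) B)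
  simp only [dd_fs] at this
  exact this

lemma EXs2 {m : ℕ} (i : Fin m) (A : PD m) :
    ∑ j : Fin m, ∫ B, H2 i j A B ∂(nuM m) ≤ √(3*m) * ∫ B, Hh i A B ∂(nuM m) := by
  have hm : Measurable (h1f (pr i A)) :=
    meas2 h1f_meas (u := fun _ : ℝ => pr i A) (v := fun b => b) (by fun_prop) (by fun_prop)
  exact flip_le (m := m) hm (h1f_bound (pr i A))

lemma EXt1 (m : ℕ) (hm : 2 ≤ m) : (m:ℝ) * (m * ((1/128) * (1/128))) ≤
    ∑ i : Fin m, ∑ j : Fin m, ∫ A, ∫ B, H2 i j A B ∂(nuM m) ∂(nuM m) := by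
  calc (m:ℝ) * (m * ((1/128) * (1/128))) = ∑ i : Fin m, ∑ j : Fin m, (1/128:ℝ) * (1/128) := by simp
      _ ≤ _ := Finset.sum_le_sum fun i _ => Finset.sum_le_sum fun j _ => h2_lower m hm i j

lemma EXt2 (m : ℕ) : ∑ i : Fin m, ∑ j : Fin m, ∫ A, ∫ B, H2 i j A B ∂(nuM m) ∂(nuM m)
      ≤ ∑ i : Fin m, √(3*m) * ∫ A, ∫ B, Hh i A B ∂(nuM m) ∂(nuM m) := by
  refine Finset.sum_le_sum fun i _ => ?_
  have hi : ∀ j : Fin m, Integrable (fun A => ∫ B, H2 i j A B ∂(nuM m)) (nuM m) :=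
    fun j => bint2 (H2_meas i j) (H2_bound i j)
  rw [← integral_finsetSum _ fun j _ => hi j, ← integral_const_mul]
  refine integral_mono (integrable_finsetSum _ fun j _ => hi j) ?_ fun A => EXs2 i A
  exact (bint2 (Hh_meas i) (Hh_bound i)).const_mul _

lemma EXt3 (m : ℕ) : ∑ i : Fin m, ∫ A, ∫ B, Hh i A B ∂(nuM m) ∂(nuM m)
    ≤ √(3*m) * ∫ A, ∫ B, Xa A B ∂(nuM m) ∂(nuM m) := by
  have hi : ∀ i : Fin m, Integrable (fun B => ∫ A, Hh i A B ∂(nuM m)) (nuM m) :=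
    fun i => bint2 (F := fun B A => Hh i A B) (meas2 (f := Hh i) (Hh_meas i) measurable_snd measurable_fst)
      (fun B A => Hh_bound i A B)
  rw [Finset.sum_congr rfl fun i _ => bswap (μ := nuM m) (ν := nuM m) (Hh_meas i) (Hh_bound i),
    bswap (Xa_meas m) Xa_bound,
      ← integral_finsetSum _ fun j _ => hi j, ← integral_const_mul]
  refine integral_mono (integrable_finsetSum _ fun j _ => hi j) ?_ EXs1
  exact (bint2 (F := fun B A => Xa A B) (meas2 (f := Xa) (Xa_meas m) measurable_snd measurable_fst) (fun A B => Xa_bound B A)).const_mul _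

lemma EX_lower (m : ℕ) (hm : 2 ≤ m) :
    (m:ℝ)/(3*2^14) ≤ ∫ A, ∫ B, |Xf A B| ∂(nuM m) ∂(nuM m) := by
  have t1 := EXt1 m hm
  have t2 := EXt2 m
  have t3 := EXt3 m
  rw [← Finset.mul_sum] at t2
  have hsq : √(3*m) * √(3*m) = 3*(m:ℝ) := Real.mul_self_sqrt (by positivity)
  have hs0 : 0 ≤ √(3*(m:ℝ)) := Real.sqrt_nonneg _
  change _ ≤ ∫ A, ∫ B, Xa A B ∂(nuM m) ∂(nuM m)
  generalize (∫ A, ∫ B, Xa A B ∂(nuM m) ∂(nuM m)) = E at *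
  have t4 : (m:ℝ) * (m * ((1/128) * (1/128))) ≤ 3*m*E := by
    calc _ ≤ _ := t1.trans t2
      _ ≤ √(3*m) * (√(3*m) * E) := by gcongr
      _ = _ := by rw [← mul_assoc, hsq]
  have hmp : (0:ℝ) < m := by positivity
  have : (m:ℝ) * (1/128 * (1/128)) ≤ 3 * E := by
    refine le_of_mul_le_mul_left (t4.trans (le_of_eq ?_)) hmp; ring
  rw [div_le_iff₀ (by norm_num)]
  linarith

open MeasureTheory ProbabilityTheory Set
set_option linter.unusedSimpArgs false

lemma sq_bd {x M : ℝ} (h : |x| ≤ M) : |x^2| ≤ M^2 := by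
  rw [abs_pow]; exact pow_le_pow_left₀ (abs_nonneg _) h 2

lemma sumN_bound {m : ℕ} {g : ℝ → ℝ} {M : ℝ} (h : ∀ x, |g x| ≤ M) (x : Fin m → ℝ) : |∑ i, g (x i)| ≤ m * M := by
  refine (Finset.abs_sum_le_sum_abs _ _).trans ?_
  refine (Finset.sum_le_sum fun j _ => h _).trans (le_of_eq ?_)
  simp

lemma lamN_sq {m : ℕ} {g : ℝ → ℝ} (hg : Measurable g) {M : ℝ} (h : ∀ x, |g x| ≤ M) (h0 : ∫ x, g x ∂lam = 0) :
    ∫ x, (∑ i, g (x i))^2 ∂(lamN m) = m * ∫ x, g x^2 ∂lam := by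
  have hL : MemLp g 2 lam := MemLp.of_bound hg.aestronglyMeasurable M
    (Filter.Eventually.of_forall fun x => by simpa using h x)
  have hv := variance_sum_pi (ι := Fin m) (μ := fun _ => lam) (X := fun _ => g) (fun _ => hL)
  have e1 : Var[g; lam] = ∫ x, g x^2 ∂lam := variance_of_integral_eq_zero hg.aemeasurable h0
  have hms : Measurable (∑ i : Fin m, fun ω : Fin m → ℝ => g (ω i)) :=
by
    have : (∑ i : Fin m, fun ω : Fin m → ℝ => g (ω i)) = fun ω => ∑ i : Fin m, g (ω i) := by
      ext ω; simp
    rw [this]; fun_prop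
  have hi : ∀ i : Fin m, ∫ x, g (x i) ∂(lamN m) = 0 := fun i => by
    rw [mp_int (lamN_eval m i) hg.aestronglyMeasurable, h0]
  have e2 : Var[∑ i : Fin m, fun ω : Fin m → ℝ => g (ω i); lamN m] = ∫ x, ((∑ i : Fin m, fun ω : Fin m → ℝ => g (ω i)) x)^2 ∂(lamN m) := by
    refine variance_of_integral_eq_zero hms.aemeasurable ?_
    simp only [Finset.sum_apply]
    rw [integral_finsetSum]
    · simp [hi]
    · intro i _
      exact bint (hg.comp (measurable_pi_apply i)) (fun x => h _)
  simp only [Finset.sum_apply] at e2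
  rw [← e2]
  refine (show _ = _ from hv).trans ?_
  rw [e1]; simp

lemma nu_fst_sq {m : ℕ} {g : ℝ → ℝ} (hg : Measurable g) {M : ℝ} (h : ∀ x, |g x| ≤ M) (h0 : ∫ x, g x ∂lam = 0) :
    ∫ A, (∑ i, g (A.1 i))^2 ∂(nuM m) ≤ 2 * m * ∫ x, g x^2 ∂lam := by
  have hms : Measurable (fun x : Fin m → ℝ => (∑ i, g (x i))^2) := by fun_prop
  have hitg : Integrable (fun x : Fin m → ℝ => (∑ i, g (x i))^2) (lamN m) :=
    bint hms (fun x => sq_bd (sumN_bound h x))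
  have e : ∫ A, (∑ i, g (A.1 i))^2 ∂(nuM m) = ∫ x, (∑ i, g (x i))^2 ∂((nuM m).map Prod.fst) := by
    rw [integral_map measurable_fst.aemeasurable hms.aestronglyMeasurable]
  rw [e]
  refine (integral_mono_measure (nuM_map_fst m) (Filter.Eventually.of_forall fun x => sq_nonneg _)
    (hitg.smul_measure (by simp))).trans ?_
  rw [integral_smul_measure, lamN_sq hg h h0]
  simp; linarith

lemma nu_snd_sq {m : ℕ} {g : ℝ → ℝ} (hg : Measurable g) {M : ℝ} (h : ∀ x, |g x| ≤ M) (h0 : ∫ x, g x ∂lam = 0) :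
    ∫ A, (∑ i, g (A.2 i))^2 ∂(nuM m) ≤ 2 * m * ∫ x, g x^2 ∂lam := by
  have hms : Measurable (fun A : PD m => (∑ i, g (A.1 i))^2) := by fun_prop
  have := mp_int (nuM_swap m) hms.aestronglyMeasurable
  simp only [Prod.fst_swap] at this
  rw [this]; exact nu_fst_sq hg h h0

/-- L2 bound keeping the last face. -/
lemma fs_sq {m : ℕ} {g : ℝ → ℝ} (hg : Measurable g) {M : ℝ} (h : ∀ x, |g x| ≤ M) (h0 : ∫ x, g x ∂lam = 0) :
    ∫ A, (fs g A)^2 ∂(nuM m) ≤ 12 * m * (∫ x, g x^2 ∂lam) + 3 * ∫ A, (g (lastF A))^2 ∂(nuM m) := by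
  have hl := lastF_meas m
  have i1 : Integrable (fun A : PD m => (∑ i, g (A.1 i))^2) (nuM m) :=
    bint (by fun_prop) (fun x => sq_bd (sumN_bound h _))
  have i2 : Integrable (fun A : PD m => (∑ i, g (A.2 i))^2) (nuM m) :=
    bint (by fun_prop) (fun x => sq_bd (sumN_bound h _))
  have i3 : Integrable (fun A : PD m => (g (lastF A))^2) (nuM m) :=
    bint (by fun_prop) (fun x => sq_bd (h _))
  have h1 : ∫ A, (fs g A)^2 ∂(nuM m) ≤ ∫ A, 3 * ((∑ i, g (A.1 i))^2 + (∑ i, g (A.2 i))^2 + (g (lastF A))^2) ∂(nuM m) := by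
    refine integral_mono (bint ((fs_meas g hg).pow_const 2) (fun x => sq_bd (fs_bound h x)))
      (((i1.add i2).add i3).const_mul 3) fun A => ?_
    simp only [fs_expand]
    nlinarith [sq_nonneg ((∑ i, g (A.1 i)) - (∑ i, g (A.2 i))), sq_nonneg ((∑ i, g (A.1 i)) - g (lastF A)), sq_nonneg ((∑ i, g (A.2 i)) - g (lastF A))]
  rw [integral_const_mul, integral_add (f := fun A : PD m => (∑ i, g (A.1 i))^2 + (∑ i, g (A.2 i))^2) (i1.add i2) i3, integral_add i1 i2] at h1
  have := nu_fst_sq (m := m) hg h h0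
  have := nu_snd_sq (m := m) hg h h0
  linarith

lemma last_sq {m : ℕ} {g : ℝ → ℝ} (hg : Measurable g) {M : ℝ} (h : ∀ x, |g x| ≤ M) :
    ∫ A, (g (lastF A))^2 ∂(nuM m) ≤ M^2 := by
  have hl := lastF_meas m
  refine (integral_mono (g := fun _ => M^2) (bint (by fun_prop) (fun x => sq_bd (h _))) (integrable_const _) fun A => ?_).trans ?_
  · exact (le_abs_self _).trans (sq_bd (h _))
  · simp

lemma fs_sq' {m : ℕ} {g : ℝ → ℝ} (hg : Measurable g) {M : ℝ} (h : ∀ x, |g x| ≤ M) (h0 : ∫ x, g x ∂lam = 0) :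
    ∫ A, (fs g A)^2 ∂(nuM m) ≤ 12 * m * (∫ x, g x^2 ∂lam) + 3 * M^2 := by
  have := fs_sq (m := m) hg h h0
  have := last_sq (m := m) hg h
  linarith

lemma sq_int_le {g : ℝ → ℝ} (hg : Measurable g) {M : ℝ} (h : ∀ x, |g x| ≤ M) : ∫ x, g x^2 ∂lam ≤ M^2 := by
  refine (integral_mono (g := fun _ => M^2) (bint (by fun_prop) (fun x => sq_bd (h _))) (integrable_const _) fun A => ?_).trans ?_
  · exact (le_abs_self _).trans (sq_bd (h _))
  · simp

lemma ker_sq {m : ℕ} {r : ℝ → ℝ → ℝ} (hr : Measurable fun p : ℝ × ℝ => r p.1 p.2) {M : ℝ} (h : ∀ x y, |r x y| ≤ M)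
    (h1 : ∀ x, ∫ y, r x y ∂lam = 0) (h2 : ∀ y, ∫ x, r x y ∂lam = 0) :
    ∫ B, ∫ A, (fs (fun a => fs (fun b => r a b) B) A)^2 ∂(nuM m) ∂(nuM m) ≤
      144 * m^2 * (∫ x, ∫ y, r x y^2 ∂lam ∂lam) + (72*m+9)*M^2 := by
  have hl := lastF_meas m
  have hrx : ∀ x, Measurable (r x) := fun x => meas2 hr measurable_const measurable_id
  have hG : Measurable fun p : PD m × ℝ => fs (fun b => r p.2 b) p.1 :=
    fs_meas2 (α := PD m × ℝ) (f := fun p b => r p.2 b)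
      (meas2 hr (u := fun q : (PD m × ℝ) × ℝ => q.1.2) (v := fun q => q.2) (by fun_prop) (by fun_prop))
      (B := fun p => p.1) measurable_fst
  have hGB : ∀ B : PD m, Measurable fun a => fs (fun b => r a b) B := fun B =>
    meas2 (f := fun (B : PD m) a => fs (fun b => r a b) B) hG measurable_const measurable_id
  have bG : ∀ (B : PD m) a, |fs (fun b => r a b) B| ≤ (2*m+1)*M := fun B a => fs_bound (h a) B
  have zG : ∀ B : PD m, ∫ a, fs (fun b => r a b) B ∂lam = 0 := by
    intro B
    unfold fs
    rw [integral_finsetSum]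
    · exact Finset.sum_eq_zero fun j _ => h2 _
    · intro j _
      exact bint (meas2 hr measurable_id measurable_const) (fun x => h x _)
  have hG2 : Measurable fun p : PD m × ℝ => (fs (fun b => r p.2 b) p.1)^2 := hG.pow_const 2
  have hG3 : Measurable fun p : PD m × PD m => (fs (fun b => r (lastF p.2) b) p.1)^2 :=
    meas2 (f := fun (B : PD m) a => (fs (fun b => r a b) B)^2) hG2 (u := fun p : PD m × PD m => p.1) (v := fun p => lastF p.2)
      (by fun_prop) (by fun_prop)
  have bG2 : ∀ (B : PD m) a, |(fs (fun b => r a b) B)^2| ≤ ((2*m+1)*M)^2 := fun B a => sq_bd (bG B a)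
  have i1 : Integrable (fun B : PD m => ∫ x, (fs (fun b => r x b) B)^2 ∂lam) (nuM m) :=
    bint2 (F := fun (B : PD m) a => (fs (fun b => r a b) B)^2) hG2 bG2
  have i2 : Integrable (fun B : PD m => ∫ A, (fs (fun b => r (lastF A) b) B)^2 ∂(nuM m)) (nuM m) :=
    bint2 (F := fun (B : PD m) (A : PD m) => (fs (fun b => r (lastF A) b) B)^2) hG3 (fun B A => bG2 B _)
  have hX : Measurable fun p : PD m × PD m => (fs (fun a => fs (fun b => r a b) p.1) p.2)^2 := by
    have := fs_meas2 (α := PD m × PD m) (f := fun p a => fs (fun b => r a b) p.1)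
      (meas2 (f := fun (B : PD m) a => fs (fun b => r a b) B) hG (u := fun q : (PD m × PD m) × ℝ => q.1.1)
        (v := fun q => q.2) (by fun_prop) (by fun_prop)) (B := fun p => p.2) measurable_snd
    exact this.pow_const 2
  have i0 : Integrable (fun B : PD m => ∫ A, (fs (fun a => fs (fun b => r a b) B) A)^2 ∂(nuM m)) (nuM m) :=
    bint2 (F := fun (B : PD m) (A : PD m) => (fs (fun a => fs (fun b => r a b) B) A)^2) hX
      (fun B A => sq_bd (fs_bound (bG B) A))
  have step1 : ∫ B, ∫ A, (fs (fun a => fs (fun b => r a b) B) A)^2 ∂(nuM m) ∂(nuM m) ≤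
      ∫ B : PD m, (12*m*(∫ x, (fs (fun b => r x b) B)^2 ∂lam) + 3 * ∫ A, (fs (fun b => r (lastF A) b) B)^2 ∂(nuM m)) ∂(nuM m) :=
    integral_mono i0 ((i1.const_mul _).add (i2.const_mul _)) fun B => fs_sq (hGB B) (bG B) (zG B)
  rw [integral_add (i1.const_mul _) (i2.const_mul _), integral_const_mul, integral_const_mul,
    bswap (F := fun (B : PD m) a => (fs (fun b => r a b) B)^2) hG2 bG2,
    bswap (F := fun (B : PD m) (A : PD m) => (fs (fun b => r (lastF A) b) B)^2) hG3 (fun B A => bG2 B _)] at step1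
  have hr2 : Measurable fun p : ℝ × ℝ => r p.1 p.2 ^2 := hr.pow_const 2
  have ir : Integrable (fun x => ∫ y, r x y^2 ∂lam) lam := bint2 hr2 (fun x y => sq_bd (h x y))
  have s1 : ∫ x, ∫ B : PD m, (fs (fun b => r x b) B)^2 ∂(nuM m) ∂lam ≤ 12*m*(∫ x, ∫ y, r x y^2 ∂lam ∂lam) + 3*M^2 := by
    refine (integral_mono (g := fun x => 12*m*(∫ y, r x y^2 ∂lam) + 3*M^2) ?_ ((ir.const_mul _).add (integrable_const _)) fun x => fs_sq' (hrx x) (h x) (h1 x)).trans (le_of_eq ?_)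
    · exact bint2 (F := fun a (B : PD m) => (fs (fun b => r a b) B)^2)
        (meas2 (f := fun (B : PD m) a => (fs (fun b => r a b) B)^2) hG2 measurable_snd measurable_fst) (fun a B => bG2 B a)
    · rw [integral_add (ir.const_mul _) (integrable_const _), integral_const_mul]; simp
  have s2 : ∫ A : PD m, ∫ B : PD m, (fs (fun b => r (lastF A) b) B)^2 ∂(nuM m) ∂(nuM m) ≤ 12*m*M^2 + 3*M^2 := by
    refine (integral_mono (g := fun _ => 12*m*M^2 + 3*M^2) ?_ (integrable_const _) fun A => ?_).trans (le_of_eq (by simp))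
    · exact bint2 (F := fun (A : PD m) (B : PD m) => (fs (fun b => r (lastF A) b) B)^2)
        (meas2 (f := fun (B : PD m) (A : PD m) => (fs (fun b => r (lastF A) b) B)^2) hG3 measurable_snd measurable_fst) (fun a B => bG2 B _)
    · refine (fs_sq' (hrx _) (h _) (h1 _)).trans ?_
      have := sq_int_le (hrx (lastF A)) (h (lastF A))
      have : 12 * (m:ℝ) * (∫ y, r (lastF A) y^2 ∂lam) ≤ 12*m*M^2 := by gcongr
      linarith
  have s1' := mul_le_mul_of_nonneg_left s1 (by positivity : (0:ℝ) ≤ 12*m)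
  nlinarith

open MeasureTheory ProbabilityTheory Set
set_option linter.unusedSimpArgs false

noncomputable def clp (x : ℝ) : ℝ := max 0 (min x 1)
lemma clp_meas : Measurable clp := by unfold clp; fun_prop
lemma clp_mem (x : ℝ) : 0 ≤ clp x ∧ clp x ≤ 1 := by
  unfold clp; exact ⟨le_max_left _ _, max_le zero_le_one (min_le_right _ _)⟩
lemma clp_id {x : ℝ} (h : x ∈ Icc (0:ℝ) 1) : clp x = x := by
  unfold clp; rw [min_eq_left h.2, max_eq_right h.1]

noncomputable def uu (K k : ℕ) (a : ℝ) : ℝ := (Ico ((k:ℝ)/K) ((k+1:ℝ)/K)).indicator (fun _ => (1:ℝ)) a - 1/K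
noncomputable def vv (K k : ℕ) (b : ℝ) : ℝ := (Iio ((k:ℝ)/K)).indicator (fun _ => (1:ℝ)) b - k/K

lemma uu_meas (K k : ℕ) : Measurable (uu K k) := by
  unfold uu; exact (measurable_const.indicator measurableSet_Ico).sub measurable_const
lemma vv_meas (K k : ℕ) : Measurable (vv K k) := by
  unfold vv; exact (measurable_const.indicator measurableSet_Iio).sub measurable_const

lemma ind_mem01 (S : Set ℝ) (x : ℝ) : 0 ≤ S.indicator (fun _ => (1:ℝ)) x ∧ S.indicator (fun _ => (1:ℝ)) x ≤ 1 := by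
  by_cases h : x ∈ S
  · rw [indicator_of_mem h]; norm_num
  · rw [indicator_of_notMem h]; norm_num

lemma uu_bound (K k : ℕ) (hK : 1 ≤ K) (a : ℝ) : |uu K k a| ≤ 1 := by
  have h := ind_mem01 (Ico ((k:ℝ)/K) ((k+1:ℝ)/K)) a
  have hK' : (1:ℝ) ≤ K := by exact_mod_cast hK
  have h1 : 1/(K:ℝ) ≤ 1 := by rw [div_le_one (by linarith)]; exact hK'
  have h2 : 0 ≤ 1/(K:ℝ) := by positivity
  unfold uu; rw [abs_le]; constructor <;> linarith [h.1, h.2]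

lemma vv_bound (K k : ℕ) (hk : k < K) (a : ℝ) : |vv K k a| ≤ 1 := by
  have h := ind_mem01 (Iio ((k:ℝ)/K)) a
  have hK' : (k:ℝ) < K := by exact_mod_cast hk
  have h1 : (k:ℝ)/(K:ℝ) ≤ 1 := by rw [div_le_one (by linarith [k.cast_nonneg (α := ℝ)])]; exact hK'.le
  have h2 : 0 ≤ (k:ℝ)/(K:ℝ) := by positivity
  unfold vv; rw [abs_le]; constructor <;> linarith [h.1, h.2]

lemma lam_real_Iio (x : ℝ) : lam.real (Iio x) = clp x := by
  unfold lam
  rw [measureReal_restrict_apply measurableSet_Iio]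
  have : (Iio x ∩ Icc 0 1 : Set ℝ) =ᵐ[volume] Icc (0:ℝ) (min x 1) := by
    have h1 : (Iio x : Set ℝ) =ᵐ[volume] Iic x := Iio_ae_eq_Iic
    refine (ae_eq_set_inter h1 (ae_eq_refl (Icc (0:ℝ) 1))).trans ?_
    have : Iic x ∩ Icc 0 1 = Icc (0:ℝ) (min x 1) := by ext y; simp; tauto
    rw [this]; exact ae_eq_refl _
  rw [measureReal_congr this, Measure.real, Real.volume_Icc, ENNReal.toReal_ofReal']
  unfold clp; rw [sub_zero, max_comm]

lemma lam_real_Ioi (x : ℝ) : lam.real (Ioi x) = 1 - clp x := by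
  have h1 : (Iio x : Set ℝ) =ᵐ[lam] Iic x := by
    unfold lam; exact Iio_ae_eq_Iic.filter_mono (ae_mono Measure.restrict_le_self)
  have : Ioi x = (Iic x)ᶜ := by simp
  rw [this, probReal_compl_eq_one_sub measurableSet_Iic, ← measureReal_congr h1, lam_real_Iio]

lemma int_id_lam : ∫ x, clp x ∂lam = 1/2 := by
  have : ∫ x, clp x ∂lam = ∫ x, x ∂lam := by
    refine integral_congr_ae ?_
    filter_upwards [lam_ae] with x hx using clp_id hx
  rw [this, lam, integral_Icc_eq_integral_Ioc, ← intervalIntegral.integral_of_le zero_le_one]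
  simp

lemma int_ind_lam {S : Set ℝ} (hS : MeasurableSet S) : ∫ x, S.indicator (fun _ => (1:ℝ)) x ∂lam = lam.real S := by
  rw [integral_indicator hS]; simp

lemma int_ind_lam_i {S : Set ℝ} (hS : MeasurableSet S) : Integrable (S.indicator (fun _ => (1:ℝ))) lam :=
  (integrable_const _).indicator hS

lemma uu_int (K k : ℕ) (hk : k < K) : ∫ x, uu K k x ∂lam = 0 := by
  have hK : (0:ℝ) < K := by exact_mod_cast (by omega : 0 < K)
  unfold uu
  rw [integral_sub (int_ind_lam_i measurableSet_Ico) (integrable_const _), int_ind_lam measurableSet_Ico]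
  have hsub : Ico ((k:ℝ)/K) ((k+1:ℝ)/K) ∩ Icc 0 1 = Ico ((k:ℝ)/K) ((k+1:ℝ)/K) := by
    rw [inter_eq_left]
    intro x hx
    refine ⟨le_trans (by positivity) hx.1, hx.2.le.trans ?_⟩
    rw [div_le_one hK]; exact_mod_cast hk
  rw [lam, measureReal_restrict_apply measurableSet_Ico, hsub, Measure.real, Real.volume_Ico,
    ENNReal.toReal_ofReal]
  · simp; field_simp; ring
  · rw [← sub_div]; apply div_nonneg <;> linarith

lemma vv_int (K k : ℕ) (hk : k < K) : ∫ x, vv K k x ∂lam = 0 := by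
  have hK : (0:ℝ) < K := by exact_mod_cast (by omega : 0 < K)
  have hk' : (k:ℝ) ≤ K := by exact_mod_cast hk.le
  unfold vv
  rw [integral_sub (int_ind_lam_i measurableSet_Iio) (integrable_const _), int_ind_lam measurableSet_Iio,
    lam_real_Iio, clp_id ⟨by positivity, by rw [div_le_one hK]; exact hk'⟩]
  simp

noncomputable def Et (K : ℕ) (a b : ℝ) : ℝ := ∑ k ∈ Finset.range K, uu K k a * vv K k b
noncomputable def th (a b : ℝ) : ℝ := (Iio a).indicator (fun _ => (1:ℝ)) b
noncomputable def rr (K : ℕ) (a b : ℝ) : ℝ := th a b - clp a + clp b - 1/2 - Et K a b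

lemma th_meas : Measurable fun p : ℝ × ℝ => th p.1 p.2 := by
  have : (fun p : ℝ × ℝ => th p.1 p.2) = {p : ℝ × ℝ | p.2 < p.1}.indicator (fun _ => (1:ℝ)) := by
    classical
    ext p; simp [th, indicator_apply]
  rw [this]
  exact measurable_const.indicator (measurableSet_lt measurable_snd measurable_fst)

lemma Et_meas (K : ℕ) : Measurable fun p : ℝ × ℝ => Et K p.1 p.2 := by
  unfold Et
  exact Finset.measurable_fun_sum _ fun k _ =>
    ((uu_meas K k).comp measurable_fst).fun_mul ((vv_meas K k).comp measurable_snd)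

lemma rr_meas (K : ℕ) : Measurable fun p : ℝ × ℝ => rr K p.1 p.2 := by
  unfold rr
  exact (((th_meas.sub (clp_meas.comp measurable_fst)).add (clp_meas.comp measurable_snd)).sub measurable_const).sub (Et_meas K)

lemma Et_bound (K : ℕ) (a b : ℝ) : |Et K a b| ≤ K := by
  unfold Et
  refine (Finset.abs_sum_le_sum_abs _ _).trans ?_
  have : ∑ k ∈ Finset.range K, (1:ℝ) = K := by simp
  rw [← this]
  refine Finset.sum_le_sum fun k hk => ?_
  have hk := Finset.mem_range.1 hk
  rw [abs_mul]
  exact mul_le_one₀ (uu_bound K k (by omega) a) (abs_nonneg _) (vv_bound K k hk b)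

lemma rr_bound (K : ℕ) (a b : ℝ) : |rr K a b| ≤ K + 3 := by
  have h1 := abs_le.1 (Et_bound K a b)
  have h2 := ind_mem01 (Iio a) b
  have h3 := clp_mem a
  have h4 := clp_mem b
  unfold rr th
  rw [abs_le]; constructor <;> linarith [h1.1, h1.2, h2.1, h2.2, h3.1, h3.2, h4.1, h4.2]

lemma clp_i : Integrable clp lam := bint clp_meas (M := 1) fun x => by
  rw [abs_le]; constructor <;> linarith [(clp_mem x).1, (clp_mem x).2]

lemma rr_int_y (K : ℕ) (a : ℝ) : ∫ b, rr K a b ∂lam = 0 := by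
  have hE : ∫ b, Et K a b ∂lam = 0 := by
    unfold Et
    rw [integral_finsetSum]
    · refine Finset.sum_eq_zero fun k hk => ?_
      rw [integral_const_mul, vv_int K k (Finset.mem_range.1 hk), mul_zero]
    · intro k hk
      exact (bint (vv_meas K k) (vv_bound K k (Finset.mem_range.1 hk))).const_mul _
  have i0 : Integrable (fun b => Et K a b) lam := bint (meas2 (Et_meas K) measurable_const measurable_id) (Et_bound K a)
  have i1 : Integrable (fun b => th a b) lam := int_ind_lam_i measurableSet_Iio
  have e1 : ∫ b, th a b ∂lam = clp a := (int_ind_lam measurableSet_Iio).trans (lam_real_Iio a)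
  have i2 : Integrable (fun b => th a b - clp a) lam := i1.sub (integrable_const _)
  have i3 : Integrable (fun b => th a b - clp a + clp b) lam := i2.add clp_i
  have i4 : Integrable (fun b => th a b - clp a + clp b - 1/2) lam := i3.sub (integrable_const _)
  unfold rr
  rw [integral_sub i4 i0, integral_sub i3 (integrable_const _), integral_add i2 clp_i, integral_sub i1 (integrable_const _), e1,
    int_id_lam, hE]
  simp

lemma rr_int_x (K : ℕ) (b : ℝ) : ∫ a, rr K a b ∂lam = 0 := by
  have hE : ∫ a, Et K a b ∂lam = 0 := by
    unfold Et
    rw [integral_finsetSum]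
    · refine Finset.sum_eq_zero fun k hk => ?_
      rw [integral_mul_const, uu_int K k (Finset.mem_range.1 hk), zero_mul]
    · intro k hk
      exact (bint (uu_meas K k) (uu_bound K k (by have := Finset.mem_range.1 hk; omega))).mul_const _
  have i0 : Integrable (fun a => Et K a b) lam :=
    bint (meas2 (f := Et K) (Et_meas K) measurable_id measurable_const) (fun a => Et_bound K a b)
  have et : (fun a => th a b) = (Ioi b).indicator (fun _ => (1:ℝ)) := by
    classical
    ext a; simp [th, indicator_apply]
  have i1 : Integrable (fun a => th a b) lam := by rw [et]; exact int_ind_lam_i measurableSet_Ioi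
  have e1 : ∫ a, th a b ∂lam = 1 - clp b := by
    rw [et]; exact (int_ind_lam measurableSet_Ioi).trans (lam_real_Ioi b)
  have i2 : Integrable (fun a => th a b - clp a) lam := i1.sub clp_i
  have i3 : Integrable (fun a => th a b - clp a + clp b) lam := i2.add (integrable_const _)
  have i4 : Integrable (fun a => th a b - clp a + clp b - 1/2) lam := i3.sub (integrable_const _)
  unfold rr
  rw [integral_sub i4 i0, integral_sub i3 (integrable_const _), integral_add i2 (integrable_const _), integral_sub i1 clp_i, e1,
    int_id_lam, hE]
  simp only [integral_const, probReal_univ, one_smul]; ring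

lemma Et_closed (K : ℕ) (a b : ℝ) (ha : a ∈ Ico (0:ℝ) 1) (hb : b ∈ Ico (0:ℝ) 1) (hK : 0 < K) :
    Et K a b = (if ⌊K*b⌋₊ < ⌊K*a⌋₊ then 1 else 0) - (⌊K*a⌋₊:ℝ)/K + (⌊K*b⌋₊:ℝ)/K - ((K:ℝ)-1)/(2*K) := by
  have hK0 : (0:ℝ) < K := by exact_mod_cast hK
  have hKa : 0 ≤ K * a := mul_nonneg hK0.le ha.1
  have hKb : 0 ≤ K * b := mul_nonneg hK0.le hb.1
  set κ := ⌊K*a⌋₊ with hκ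
  set β := ⌊K*b⌋₊ with hβ
  have hκK : κ < K := by
    rw [hκ, Nat.floor_lt hKa]; nlinarith [ha.2]
  have hβK : β < K := by
    rw [hβ, Nat.floor_lt hKb]; nlinarith [hb.2]
  have hu : ∀ k, uu K k a = (if k = κ then 1 else 0) - 1/K := by
    intro k
    classical
    unfold uu
    rw [indicator_apply]
    congr 1
    have : a ∈ Ico ((k:ℝ)/K) ((k+1:ℝ)/K) ↔ k = κ := by
      rw [eq_comm, hκ, Nat.floor_eq_iff hKa, mem_Ico, div_le_iff₀ hK0, lt_div_iff₀ hK0, mul_comm]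
    simp only [this]
  have hv : ∀ k, vv K k b = (if β < k then 1 else 0) - k/K := by
    intro k
    classical
    unfold vv
    rw [indicator_apply]
    congr 1
    have : b ∈ Iio ((k:ℝ)/K) ↔ β < k := by
      rw [hβ, Nat.floor_lt hKb, mem_Iio, lt_div_iff₀ hK0, mul_comm]
    simp only [this]
  have s1 : ∑ k ∈ Finset.range K, (if β < k then (1:ℝ) else 0) = K - 1 - β := by
    rw [Finset.sum_boole]
    have : (Finset.range K).filter (fun k => β < k) = Finset.Ioo β K := by
      ext k; simp; tauto
    rw [this, Nat.card_Ioo, Nat.cast_sub (by omega), Nat.cast_sub (by omega)]; push_cast; ring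
  have s2 : ∑ k ∈ Finset.range K, (k:ℝ) = K*(K-1)/2 := by
    have := Finset.sum_range_id_mul_two K
    have h2 : ((∑ i ∈ Finset.range K, i : ℕ):ℝ) * 2 = K * ((K - 1 : ℕ):ℝ) := by exact_mod_cast this
    rw [Nat.cast_sub (by omega)] at h2
    push_cast at h2
    linarith
  unfold Et
  simp only [hu, hv]
  have : ∀ k ∈ Finset.range K, ((if k = κ then (1:ℝ) else 0) - 1/K) * ((if β < k then 1 else 0) - k/K) =
      (if k = κ then ((if β < κ then (1:ℝ) else 0) - κ/K) else 0) - (1/K) * (if β < k then 1 else 0) + (1/(K:ℝ)^2) * k := by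
    intro k _
    by_cases h : k = κ
    · subst h; simp only [if_true]; field_simp; ring
    · simp only [h, if_false]; field_simp; ring
  rw [Finset.sum_congr rfl this, Finset.sum_add_distrib, Finset.sum_sub_distrib, ← Finset.mul_sum, ← Finset.mul_sum, s1, s2,
    Finset.sum_ite_eq' ]
  rw [if_pos (Finset.mem_range.2 hκK)]
  field_simp
  ring

lemma rr_sq (K : ℕ) (hK : 0 < K) (a b : ℝ) (ha : a ∈ Ico (0:ℝ) 1) (hb : b ∈ Ico (0:ℝ) 1) :
    (rr K a b)^2 ≤ 4/K + 9 * (Ioo (a - 1/K) (a + 1/K)).indicator (fun _ => (1:ℝ)) b := by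
  have hK0 : (0:ℝ) < K := by exact_mod_cast hK
  have hKa : 0 ≤ K * a := mul_nonneg hK0.le ha.1
  have hKb : 0 ≤ K * b := mul_nonneg hK0.le hb.1
  have hr : rr K a b = th a b - a + b - 1/2 - Et K a b := by
    unfold rr; rw [clp_id ⟨ha.1, ha.2.le⟩, clp_id ⟨hb.1, hb.2.le⟩]
  rw [hr, Et_closed K a b ha hb hK]
  have a1 := Nat.floor_le hKa
  have a2 := Nat.lt_floor_add_one (K*a)
  have b1 := Nat.floor_le hKb
  have b2 := Nat.lt_floor_add_one (K*b)
  have hth : th a b = if b < a then 1 else 0 := by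
    classical
    simp [th, indicator_apply]
  rw [hth]
  have mono1 : ⌊K*b⌋₊ < ⌊K*a⌋₊ → b < a := by
    intro h; by_contra h'
    push Not at h'
    exact absurd (Nat.floor_mono (mul_le_mul_of_nonneg_left h' hK0.le)) (not_le.2 h)
  have mono2 : ⌊K*a⌋₊ < ⌊K*b⌋₊ → ¬ b < a := by
    intro h h'
    exact absurd (Nat.floor_mono (mul_le_mul_of_nonneg_left h'.le hK0.le)) (not_le.2 h)
  set κ := ⌊K*a⌋₊ with hκ
  set β := ⌊K*b⌋₊ with hβ
  have ea1 : 0 ≤ a - κ/K := by rw [sub_nonneg, div_le_iff₀ hK0]; linarith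
  have ea2 : a - κ/K ≤ 1/K := by
    rw [sub_le_iff_le_add, ← add_div, le_div_iff₀ hK0]; linarith
  have eb1 : 0 ≤ b - β/K := by rw [sub_nonneg, div_le_iff₀ hK0]; linarith
  have eb2 : b - β/K ≤ 1/K := by
    rw [sub_le_iff_le_add, ← add_div, le_div_iff₀ hK0]; linarith
  have ec : ((K:ℝ)-1)/(2*K) = 1/2 - (1/K)/2 := by field_simp
  have hk1 : 1/(K:ℝ) ≤ 1 := by rw [div_le_one hK0]; exact_mod_cast hK
  have hk0 : 0 < 1/(K:ℝ) := by positivity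
  have e4 : 4/(K:ℝ) = 4 * (1/K) := by ring
  rw [e4, ec]
  have hind := ind_mem01 (Ioo (a - 1/K) (a + 1/K)) b
  set q := 1/(K:ℝ)
  rcases lt_trichotomy κ β with h | h | h
  · rw [if_neg (mono2 h), if_neg (by omega)]
    have : |0 - a + b - 1/2 - (0 - (κ:ℝ)/K + (β:ℝ)/K - (1/2 - q/2))| ≤ 2*q := by
      rw [abs_le]; constructor <;> linarith
    have := (le_abs_self _).trans (sq_bd this)
    nlinarith [hind.1]
  · have hmem : b ∈ Ioo (a - q) (a + q) := by
      have hK1 : (K:ℝ) * q = 1 := by simp only [q]; field_simp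
      rw [← h] at b1 b2
      constructor <;> nlinarith
    rw [indicator_of_mem hmem, h, if_neg (lt_irrefl β)]
    rw [h] at ea1 ea2
    have : |(if b < a then (1:ℝ) else 0) - a + b - 1/2 - (0 - (β:ℝ)/K + (β:ℝ)/K - (1/2 - q/2))| ≤ 3 := by
      rw [abs_le]; split_ifs <;> constructor <;> linarith
    have := (le_abs_self _).trans (sq_bd this)
    nlinarith
  · rw [if_pos (mono1 h), if_pos h]
    have : |1 - a + b - 1/2 - (1 - (κ:ℝ)/K + (β:ℝ)/K - (1/2 - q/2))| ≤ 2*q := by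
      rw [abs_le]; constructor <;> linarith
    have := (le_abs_self _).trans (sq_bd this)
    nlinarith [hind.1]

lemma rr_sq_int (K : ℕ) (hK : 0 < K) : ∫ x, ∫ y, rr K x y^2 ∂lam ∂lam ≤ 22/K := by
  have hlt : ∀ᵐ x ∂lam, x ∈ Ico (0:ℝ) 1 := by
    have h0 : ∀ᵐ x ∂lam, x ≠ 1 := by
      rw [ae_iff]; simpa using lam_sing 1
    filter_upwards [lam_ae, h0] with x h1 h2 using ⟨h1.1, lt_of_le_of_ne h1.2 h2⟩
  have hm : Measurable fun p : ℝ × ℝ => rr K p.1 p.2 ^2 := (rr_meas K).pow_const 2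
  have key : ∀ᵐ x ∂lam, ∫ y, rr K x y^2 ∂lam ≤ 22/K := by
    filter_upwards [hlt] with x hx
    have i1 : Integrable (fun y => 9 * (Ioo (x - 1/K) (x + 1/K)).indicator (fun _ => (1:ℝ)) y) lam :=
      (int_ind_lam_i measurableSet_Ioo).const_mul 9
    have : ∫ y, rr K x y^2 ∂lam ≤ ∫ y, (4/K + 9 * (Ioo (x - 1/K) (x + 1/K)).indicator (fun _ => (1:ℝ)) y) ∂lam := by
      refine integral_mono_ae ?_ ((integrable_const _).add i1) ?_
      · exact bint (meas2 (f := fun x y => rr K x y^2) hm measurable_const measurable_id) (fun y => sq_bd (rr_bound K x y))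
      · filter_upwards [hlt] with y hy using rr_sq K hK x y hx hy
    refine this.trans ?_
    rw [integral_add (integrable_const _) i1, integral_const_mul, int_ind_lam measurableSet_Ioo]
    have hb : lam.real (Ioo (x - 1/K) (x + 1/K)) ≤ 2 / K := by
      unfold lam
      rw [measureReal_restrict_apply measurableSet_Ioo]
      refine (measureReal_mono inter_subset_left (by simp)).trans (le_of_eq ?_)
      rw [Measure.real, Real.volume_Ioo, ENNReal.toReal_ofReal]
      · ring
      · have : 0 ≤ 1/(K:ℝ) := by positivity
        linarith
    have e : (22:ℝ)/K = 4/K + 9*(2/K) := by ring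
    rw [e]
    simp only [integral_const, probReal_univ, one_smul]
    linarith
  refine (integral_mono_ae (g := fun _ => (22:ℝ)/K) (bint2 hm (fun x y => sq_bd (rr_bound K x y))) (integrable_const _) key).trans (by simp)

open MeasureTheory ProbabilityTheory Set
set_option linter.unusedSimpArgs false

lemma mul_bd {x y M N : ℝ} (h : |x| ≤ M) (h' : |y| ≤ N) : |x * y| ≤ M * N := by
  rw [abs_mul]; exact mul_le_mul h h' (abs_nonneg _) ((abs_nonneg _).trans h)

lemma cs_int {α : Type*} [MeasurableSpace α] {μ : Measure α} [IsFiniteMeasure μ] {f g : α → ℝ} (hf : Measurable f)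
    (hg : Measurable g) {M N : ℝ} (hM : ∀ x, |f x| ≤ M) (hN : ∀ x, |g x| ≤ N) :
    (∫ x, f x * g x ∂μ)^2 ≤ (∫ x, f x^2 ∂μ) * ∫ x, g x^2 ∂μ := by
  have i1 : Integrable (fun x => f x^2) μ := bint (hf.pow_const 2) (fun x => sq_bd (hM x))
  have i2 : Integrable (fun x => g x^2) μ := bint (hg.pow_const 2) (fun x => sq_bd (hN x))
  have i3 : Integrable (fun x => f x * g x) μ := bint (hf.fun_mul hg) (fun x => mul_bd (hM x) (hN x))
  have key : ∀ t : ℝ, 0 ≤ (∫ x, g x^2 ∂μ) * (t * t) + (-2 * ∫ x, f x * g x ∂μ) * t + ∫ x, f x^2 ∂μ := by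
    intro t
    have h : 0 ≤ ∫ x, (f x - t * g x)^2 ∂μ := integral_nonneg fun x => sq_nonneg _
    have e : ∀ x, (f x - t * g x)^2 = f x^2 + (-2*t) * (f x * g x) + (t*t) * g x^2 := fun x => by ring
    simp only [e] at h
    have i4 : Integrable (fun x => f x^2 + (-2*t) * (f x * g x)) μ := i1.add (i3.const_mul _)
    rw [integral_add i4 (i2.const_mul _), integral_add i1 (i3.const_mul _), integral_const_mul, integral_const_mul] at h
    linarith
  have := discrim_le_zero key
  unfold discrim at this
  nlinarith

section CS
variable {α : Type*} [MeasurableSpace α]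

noncomputable def hh (μ : Measure α) (s : α → α → ℝ) (A C : α) : ℝ := ∫ B, s A B * s C B ∂μ
noncomputable def QQ (μ : Measure α) (s : α → α → ℝ) : ℝ := ∫ A, ∫ C, (hh μ s A C)^2 ∂μ ∂μ

variable {μ : Measure α} [IsProbabilityMeasure μ] {s : α → α → ℝ}

lemma int_meas {β : Type*} [MeasurableSpace β] {F : β → α → ℝ} (hF : Measurable fun p : β × α => F p.1 p.2) :
    Measurable fun x => ∫ y, F x y ∂μ :=
  (StronglyMeasurable.integral_prod_right hF.stronglyMeasurable).measurable

lemma int_bd {f : α → ℝ} {M : ℝ} (h : ∀ x, |f x| ≤ M) : |∫ x, f x ∂μ| ≤ M := by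
  have := norm_integral_le_of_norm_le_const (μ := μ) (f := f) (C := M) (Filter.Eventually.of_forall fun x => by simpa using h x)
  simpa using this

lemma hh_meas (hs : Measurable fun p : α × α => s p.1 p.2) : Measurable fun p : α × α => hh μ s p.1 p.2 := by
  unfold hh
  refine int_meas (F := fun (p : α × α) B => s p.1 B * s p.2 B) ?_
  exact (meas2 hs (u := fun p : (α × α) × α => p.1.1) (v := fun p => p.2) (by fun_prop) (by fun_prop)).fun_mul
    (meas2 hs (u := fun p : (α × α) × α => p.1.2) (v := fun p => p.2) (by fun_prop) (by fun_prop))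

lemma hh_bd (hb : ∀ A B, |s A B| ≤ 1) (A C : α) : |hh μ s A C| ≤ 1 * 1 :=
  int_bd fun B => mul_bd (hb _ _) (hb _ _)

lemma int_prodform {f g : α → ℝ} (hf : Measurable f)
    (hg : Measurable g) {M N : ℝ} (hM : ∀ x, |f x| ≤ M) (hN : ∀ x, |g x| ≤ N) :
    ∫ p : α × α, f p.1 * g p.2 ∂(μ.prod μ) = (∫ x, f x ∂μ) * ∫ x, g x ∂μ :=
  integral_prod_mul f g

lemma cs4 (hs : Measurable fun p : α × α => s p.1 p.2) (hb : ∀ A B, |s A B| ≤ 1) {u v : α → ℝ}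
    (hu : Measurable u) (hv : Measurable v) {M N : ℝ} (hM : ∀ x, |u x| ≤ M) (hN : ∀ x, |v x| ≤ N) :
    (∫ A, ∫ B, u A * s A B * v B ∂μ ∂μ)^4 ≤ QQ μ s * (∫ x, u x^2 ∂μ)^2 * (∫ x, v x^2 ∂μ)^2 := by
  have hus : Measurable fun p : α × α => u p.1 * s p.1 p.2 := (hu.comp measurable_fst).fun_mul hs
  have busv : ∀ A B, |u A * s A B * v B| ≤ M * 1 * N := fun A B => mul_bd (mul_bd (hM _) (hb _ _)) (hN _)
  have e1 : ∫ A, ∫ B, u A * s A B * v B ∂μ ∂μ = ∫ B, (∫ A, u A * s A B ∂μ) * v B ∂μ := by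
    rw [bswap (F := fun A B => u A * s A B * v B) (hus.fun_mul (hv.comp measurable_snd)) busv]
    simp only [integral_mul_const]
  have hw : Measurable fun B => ∫ A, u A * s A B ∂μ :=
    int_meas (F := fun B A => u A * s A B) (meas2 (f := fun A B => u A * s A B) hus measurable_snd measurable_fst)
  have bus : ∀ A B, |u A * s A B| ≤ M * 1 := fun A B => mul_bd (hM _) (hb _ _)
  have c1 := cs_int (μ := μ) hw hv (fun B => int_bd fun A => bus A B) hN
  have hF : Measurable fun q : α × (α × α) => (u q.2.1 * s q.2.1 q.1) * (u q.2.2 * s q.2.2 q.1) :=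
    (meas2 (f := fun A B => u A * s A B) hus (u := fun q : α × (α × α) => q.2.1) (v := fun q => q.1) (by fun_prop) (by fun_prop)).fun_mul
    (meas2 (f := fun A B => u A * s A B) hus (u := fun q : α × (α × α) => q.2.2) (v := fun q => q.1) (by fun_prop) (by fun_prop))
  have e2 : ∫ B, (∫ A, u A * s A B ∂μ)^2 ∂μ = ∫ p : α × α, (u p.1 * u p.2) * hh μ s p.1 p.2 ∂(μ.prod μ) := by
    have : ∀ B, (∫ A, u A * s A B ∂μ)^2 = ∫ p : α × α, (u p.1 * s p.1 B) * (u p.2 * s p.2 B) ∂(μ.prod μ) := by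
      intro B
      rw [sq, integral_prod_mul (fun A => u A * s A B) (fun A => u A * s A B)]
    simp only [this]
    rw [bswap (μ := μ) (ν := μ.prod μ) (F := fun B (p : α × α) => (u p.1 * s p.1 B) * (u p.2 * s p.2 B)) hF (fun B p => mul_bd (bus _ _) (bus _ _))]
    congr 1; funext p
    unfold hh
    rw [← integral_const_mul]
    congr 1; funext B; ring
  have c2 := cs_int (μ := μ.prod μ) (f := fun p : α × α => u p.1 * u p.2) (g := fun p => hh μ s p.1 p.2)
    ((hu.comp measurable_fst).fun_mul (hu.comp measurable_snd)) (hh_meas hs)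
    (fun p => mul_bd (hM _) (hM _)) (fun p => hh_bd hb _ _)
  have e3 : ∫ p : α × α, (u p.1 * u p.2)^2 ∂(μ.prod μ) = (∫ x, u x^2 ∂μ)^2 := by
    simp only [mul_pow]
    rw [integral_prod_mul (fun A => u A^2) (fun A => u A^2), sq (∫ x, u x^2 ∂μ)]
  have e4 : ∫ p : α × α, (hh μ s p.1 p.2)^2 ∂(μ.prod μ) = QQ μ s := by
    unfold QQ
    rw [integral_prod]
    exact bint ((hh_meas hs).pow_const 2) (fun p => sq_bd (hh_bd hb _ _))
  rw [e3, e4, ← e2] at c2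
  rw [e1]
  have hW : 0 ≤ ∫ B, (∫ A, u A * s A B ∂μ)^2 ∂μ := integral_nonneg fun _ => sq_nonneg _
  have hV : 0 ≤ ∫ x, v x^2 ∂μ := integral_nonneg fun _ => sq_nonneg _
  generalize ∫ B, (∫ A, u A * s A B ∂μ)^2 ∂μ = W at *
  generalize ∫ x, v x^2 ∂μ = V at *
  generalize ∫ B, (∫ A, u A * s A B ∂μ) * v B ∂μ = I at *
  calc I^4 = (I^2)^2 := by ring
    _ ≤ (W*V)^2 := pow_le_pow_left₀ (sq_nonneg _) c1 2
    _ = W^2 * V^2 := by ring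
    _ ≤ _ := by
      refine mul_le_mul_of_nonneg_right (c2.trans (le_of_eq (by ring))) (sq_nonneg _)
end CS

noncomputable def ss {m : ℕ} (A B : PD m) : ℝ := sg (Xf A B) 0

lemma ss_meas (m : ℕ) : Measurable fun p : PD m × PD m => ss p.1 p.2 :=
  meas2 sg_meas (u := fun p : PD m × PD m => Xf p.1 p.2) (v := fun _ => 0) (Xf_meas m) measurable_const

lemma ss_bd {m : ℕ} (A B : PD m) : |ss A B| ≤ 1 := sg_bound _ _

lemma sg_antisymm (a b : ℝ) : sg a b = - sg b a := by unfold sg; ring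

lemma mul_sg (x : ℝ) : x * sg x 0 = |x| := by
  rcases lt_trichotomy x 0 with h | h | h
  · simp [sg, h, not_lt.2 h.le, abs_of_neg h]
  · simp [h]
  · simp [sg, h, not_lt.2 h.le, abs_of_pos h]

lemma Xf_sum {m : ℕ} (A B : PD m) : Xf A B = ∑ i, ∑ j, sg (face A i) (face B j) := rfl

lemma Xf_antisymm {m : ℕ} (A B : PD m) : Xf A B = - Xf B A := by
  rw [Xf_sum, Xf_sum, Finset.sum_comm, ← Finset.sum_neg_distrib]
  refine Finset.sum_congr rfl fun j _ => ?_
  rw [← Finset.sum_neg_distrib]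
  exact Finset.sum_congr rfl fun i _ => sg_antisymm _ _

lemma ss_antisymm {m : ℕ} (A B : PD m) : ss A B = - ss B A := by
  unfold ss
  rw [Xf_antisymm A B]
  unfold sg; simp

lemma pair_ae_ne (m : ℕ) : ∀ᵐ p ∂((nuM (m+1)).prod (nuM (m+1))), ∀ i j, face p.1 i ≠ face p.2 j := by
  rw [ae_all_iff]; intro i
  rw [ae_all_iff]; intro j
  have hm : MeasurableSet {p : PD (m+1) × PD (m+1) | face p.1 i ≠ face p.2 j} := by
    have h1 : Measurable fun p : PD (m+1) × PD (m+1) => face p.1 i := (face_meas _ i).comp measurable_fst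
    have h2 : Measurable fun p : PD (m+1) × PD (m+1) => face p.2 j := (face_meas _ j).comp measurable_snd
    exact (measurableSet_eq_fun h1 h2).compl
  refine (Measure.ae_prod_iff_ae_ae hm).2 (Filter.Eventually.of_forall fun A => ?_)
  filter_upwards [face_ae_ne m (face A i)] with B hB using (hB j).symm

lemma pair_ae_mem (m : ℕ) : ∀ᵐ p ∂((nuM m).prod (nuM m)), (∀ i, face p.1 i ∈ Icc (0:ℝ) 1) ∧ (∀ j, face p.2 j ∈ Icc (0:ℝ) 1) :=
  (measurePreserving_fst.quasiMeasurePreserving.ae (face_ae_mem m)).and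
    (measurePreserving_snd.quasiMeasurePreserving.ae (face_ae_mem m))

lemma card_JJ (m : ℕ) : Fintype.card (JJ m) = 2*m+1 := by simp; ring

lemma sg_th {a b : ℝ} (h : a ≠ b) : sg a b = 2 * th a b - 1 := by
  classical
  rcases lt_or_gt_of_ne h with h | h
  · simp [sg, th, indicator_apply, h, not_lt.2 h.le]
  · simp [sg, th, indicator_apply, h, not_lt.2 h.le]; norm_num

lemma X_ne_zero {m : ℕ} {A B : PD m} (h : ∀ i j, face A i ≠ face B j) : Xf A B ≠ 0 := by
  classical
  have e : Xf A B = 2 * ((∑ i, ∑ j, (if face B j < face A i then 1 else 0) : ℕ):ℝ) - (2*m+1)*(2*m+1) := by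
    rw [Xf_sum]
    have : ∀ i j, sg (face A i) (face B j) = 2 * (if face B j < face A i then 1 else 0) - 1 := by
      intro i j; rw [sg_th (h i j)]; simp [th, indicator_apply]
    simp only [this, Finset.sum_sub_distrib, ← Finset.mul_sum]
    push_cast
    congr 1
    rw [Finset.sum_const, Finset.sum_const, Finset.card_univ, card_JJ]
    simp
    ring
  rw [e]
  intro h0
  have h1 : (2 * (∑ i, ∑ j, (if face B j < face A i then 1 else 0) : ℕ) : ℝ) = (((2*m+1)*(2*m+1) : ℕ):ℝ) := by
    push_cast at h0 ⊢; linarith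
  have h2 : 2 * (∑ i, ∑ j, (if face B j < face A i then 1 else 0) : ℕ) = (2*m+1)*(2*m+1) := by
    exact_mod_cast h1
  have h3 : Odd ((2*m+1)*(2*m+1)) := (odd_two_mul_add_one m).mul (odd_two_mul_add_one m)
  rw [← h2] at h3
  exact absurd h3 (by simp)

noncomputable def Rf {m : ℕ} (K : ℕ) (A B : PD m) : ℝ := fs (fun a => fs (fun b => rr K a b) B) A

lemma Rf_bd {m : ℕ} (K : ℕ) (A B : PD m) : |Rf K A B| ≤ (2*m+1)*((2*m+1)*(K+3)) :=
  fs_bound (fun a => fs_bound (fun b => rr_bound K a b) B) A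

lemma Rf_meas (m K : ℕ) : Measurable (fun p : PD m × PD m => Rf K p.1 p.2) := by
  have h1 : Measurable (fun q : ((PD m × PD m) × ℝ) × ℝ => rr K q.1.2 q.2) :=
    meas2 (rr_meas K) (u := fun q : ((PD m × PD m) × ℝ) × ℝ => q.1.2) (v := fun q => q.2) (by fun_prop) (by fun_prop)
  have h2 := fs_meas2 (α := (PD m × PD m) × ℝ) (f := fun q b => rr K q.2 b) h1
    (B := fun q => q.1.2) (measurable_snd.comp measurable_fst)
  exact fs_meas2 (α := PD m × PD m) (f := fun p a => fs (fun b => rr K a b) p.2) h2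
    (B := fun q => q.1) measurable_fst

lemma X_decomp {m : ℕ} (K : ℕ) {A B : PD m} (h : ∀ i j, face A i ≠ face B j)
    (hA : ∀ i, face A i ∈ Icc (0:ℝ) 1) (hB : ∀ i, face B i ∈ Icc (0:ℝ) 1) :
    Xf A B = 2 * (∑ k ∈ Finset.range K, fs (uu K k) A * fs (vv K k) B) + 2 * Rf K A B := by
  have e1 : ∑ k ∈ Finset.range K, fs (uu K k) A * fs (vv K k) B = ∑ i, ∑ j, Et K (face A i) (face B j) := by
    unfold fs Et
    simp only [Finset.sum_mul_sum]
    rw [Finset.sum_comm]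
    refine Finset.sum_congr rfl fun i _ => ?_
    rw [Finset.sum_comm]
  have e2 : Rf K A B = ∑ i, ∑ j, rr K (face A i) (face B j) := rfl
  have e3 : ∀ i j, sg (face A i) (face B j) = 2 * Et K (face A i) (face B j) + 2 * rr K (face A i) (face B j)
      + 2 * face A i - 2 * face B j := by
    intro i j
    rw [sg_th (h i j)]; unfold rr
    rw [clp_id (hA i), clp_id (hB j)]; ring
  rw [e1, e2, Xf_sum]
  simp only [e3, Finset.sum_add_distrib, Finset.sum_sub_distrib, ← Finset.mul_sum, Finset.sum_const, face_sum, nsmul_eq_mul]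
  ring

lemma Q_main (m K : ℕ) (hm : 2 ≤ m) (hK : 0 < K) (q ρ : ℝ) (hq : 0 ≤ q) (hQ : QQ (nuM m) ss ≤ q^4)
    (hρ : 0 ≤ ρ) (hρ2 : 144*m^2*(22/K) + (72*m+9)*((K:ℝ)+3)^2 ≤ ρ^2) :
    (m:ℝ)/(3*2^14) ≤ 2 * (K * (15*m*q)) + 2*ρ := by
  have hm1 : (1:ℝ) ≤ m := by exact_mod_cast (by omega : 1 ≤ m)
  refine (EX_lower m hm).trans ?_
  set ν := nuM m with hν
  have iX : Integrable (fun p : PD m × PD m => |Xf p.1 p.2|) (ν.prod ν) :=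
    (bint (Xf_meas m) (fun p => Xf_bound _ _)).abs
  have eX : ∫ A, ∫ B, |Xf A B| ∂ν ∂ν = ∫ p, |Xf p.1 p.2| ∂(ν.prod ν) := (integral_prod _ iX).symm
  have hne : ∀ᵐ p ∂(ν.prod ν), ∀ i j, face p.1 i ≠ face p.2 j := by
    obtain ⟨m', rfl⟩ : ∃ m', m = m' + 1 := ⟨m - 1, by omega⟩
    exact pair_ae_ne m'
  have eD : ∫ p, |Xf p.1 p.2| ∂(ν.prod ν) = ∫ p : PD m × PD m,
      (2 * (∑ k ∈ Finset.range K, fs (uu K k) p.1 * ss p.1 p.2 * fs (vv K k) p.2) + 2 * (Rf K p.1 p.2 * ss p.1 p.2)) ∂(ν.prod ν) := by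
    refine integral_congr_ae ?_
    filter_upwards [hne, pair_ae_mem m] with p h1 h2
    rw [← mul_sg, X_decomp K h1 h2.1 h2.2]
    have : sg (2 * (∑ k ∈ Finset.range K, fs (uu K k) p.1 * fs (vv K k) p.2) + 2 * Rf K p.1 p.2) 0 = ss p.1 p.2 := by
      rw [← X_decomp K h1 h2.1 h2.2]; rfl
    rw [this, add_mul, mul_assoc, Finset.sum_mul, mul_assoc]
    congr 2
    exact Finset.sum_congr rfl fun k _ => by ring
  have mk : ∀ k, Measurable fun p : PD m × PD m => fs (uu K k) p.1 * ss p.1 p.2 * fs (vv K k) p.2 := fun k =>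
    (((fs_meas _ (uu_meas K k)).comp measurable_fst).fun_mul (ss_meas m)).fun_mul ((fs_meas _ (vv_meas K k)).comp measurable_snd)
  have bk : ∀ k ∈ Finset.range K, ∀ p : PD m × PD m, |fs (uu K k) p.1 * ss p.1 p.2 * fs (vv K k) p.2| ≤ ((2*m+1)*1)*1*((2*m+1)*1) := fun k hk p =>
    mul_bd (mul_bd (fs_bound (uu_bound K k hK) _) (ss_bd _ _)) (fs_bound (vv_bound K k (Finset.mem_range.1 hk)) _)
  have ik : ∀ k ∈ Finset.range K, Integrable (fun p : PD m × PD m => fs (uu K k) p.1 * ss p.1 p.2 * fs (vv K k) p.2) (ν.prod ν) :=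
    fun k hk => bint (mk k) (bk k hk)
  have iR : Integrable (fun p : PD m × PD m => Rf K p.1 p.2 * ss p.1 p.2) (ν.prod ν) :=
    bint ((Rf_meas m K).fun_mul (ss_meas m)) (fun p => mul_bd (Rf_bd K _ _) (ss_bd _ _))
  rw [eX, eD, integral_add ((integrable_finsetSum _ ik).const_mul 2) (iR.const_mul 2), integral_const_mul, integral_const_mul,
    integral_finsetSum _ ik]
  have b1 : ∀ k ∈ Finset.range K, ∫ p : PD m × PD m, fs (uu K k) p.1 * ss p.1 p.2 * fs (vv K k) p.2 ∂(ν.prod ν) ≤ 15*m*q := by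
    intro k hk
    have hk' := Finset.mem_range.1 hk
    rw [integral_prod _ (ik k hk)]
    have c := cs4 (μ := ν) (s := ss) (ss_meas m) ss_bd (fs_meas _ (uu_meas K k)) (fs_meas _ (vv_meas K k))
      (fun A => fs_bound (uu_bound K k hK) A) (fun A => fs_bound (vv_bound K k hk') A)
    have l2 : ∀ g : ℝ → ℝ, Measurable g → (∀ x, |g x| ≤ 1) → ∫ x, g x ∂lam = 0 → ∫ A, (fs g A)^2 ∂ν ≤ 15*m := by
      intro g h1 h2 h3
      have t1 := fs_sq' (m := m) h1 h2 h3
      have t2 := sq_int_le h1 h2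
      have t3 : 12*(m:ℝ)*(∫ x, g x^2 ∂lam) ≤ 12*m*1^2 := by gcongr
      linarith
    have u1 := l2 _ (uu_meas K k) (uu_bound K k hK) (uu_int K k hk')
    have v1 := l2 _ (vv_meas K k) (vv_bound K k hk') (vv_int K k hk')
    have u0 : 0 ≤ ∫ A, (fs (uu K k) A)^2 ∂ν := integral_nonneg fun _ => sq_nonneg _
    have v0 : 0 ≤ ∫ A, (fs (vv K k) A)^2 ∂ν := integral_nonneg fun _ => sq_nonneg _
    have c' : (∫ A, ∫ B, fs (uu K k) A * ss A B * fs (vv K k) B ∂ν ∂ν)^4 ≤ (15*m*q)^4 := by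
      refine c.trans ?_
      calc _ ≤ q^4 * (15*m)^2 * (15*m)^2 := by gcongr
        _ = _ := by ring
    by_contra hcon
    push Not at hcon
    exact absurd c' (not_le.2 (pow_lt_pow_left₀ hcon (by positivity) (by norm_num)))
  have b2 : ∫ p : PD m × PD m, Rf K p.1 p.2 * ss p.1 p.2 ∂(ν.prod ν) ≤ ρ := by
    have c := cs_int (μ := ν.prod ν) (Rf_meas m K) (ss_meas m) (fun p => Rf_bd K _ _) (fun p => ss_bd _ _)
    have iR2 : Integrable (fun p : PD m × PD m => Rf K p.1 p.2 ^2) (ν.prod ν) :=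
      bint ((Rf_meas m K).pow_const 2) (fun p => sq_bd (Rf_bd K _ _))
    have k1 := ker_sq (m := m) (rr_meas K) (rr_bound K) (rr_int_y K) (rr_int_x K)
    have k2 : ∫ p : PD m × PD m, Rf K p.1 p.2^2 ∂(ν.prod ν) ≤ ρ^2 := by
      rw [integral_prod_symm _ iR2]
      refine (show _ ≤ _ from k1).trans (le_trans ?_ hρ2)
      have := rr_sq_int K hK
      gcongr
    have k3 : ∫ p : PD m × PD m, ss p.1 p.2^2 ∂(ν.prod ν) ≤ 1 := by
      have := int_bd (μ := ν.prod ν) (f := fun p : PD m × PD m => ss p.1 p.2^2) (M := 1^2) (fun p => sq_bd (ss_bd _ _))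
      linarith [le_abs_self (∫ p : PD m × PD m, ss p.1 p.2^2 ∂(ν.prod ν))]
    have k4 : 0 ≤ ∫ p : PD m × PD m, ss p.1 p.2^2 ∂(ν.prod ν) := integral_nonneg fun _ => sq_nonneg _
    refine le_trans (le_abs_self _) (abs_le_of_sq_le_sq (c.trans ?_) hρ)
    calc _ ≤ ρ^2 * 1 := mul_le_mul k2 k3 k4 (sq_nonneg _)
      _ = _ := mul_one _
  have b3 := Finset.sum_le_sum b1
  simp only [Finset.sum_const, Finset.card_range, nsmul_eq_mul] at b3
  linarith

lemma Q_lower : ∃ q0 > (0:ℝ), ∃ M0 : ℕ, 2 ≤ M0 ∧ ∀ m, M0 ≤ m → q0 ≤ QQ (nuM m) ss := by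
  set c : ℝ := 1/(3*2^14) with hc
  have hc0 : 0 < c := by rw [hc]; norm_num
  obtain ⟨K, hK⟩ := exists_nat_gt (144*22*32/c^2)
  have hKpos : (0:ℝ) < K := lt_trans (by positivity) hK
  have hK0 : 0 < K := by exact_mod_cast hKpos
  obtain ⟨M0, hM0⟩ := exists_nat_gt (81*((K:ℝ)+3)^2*32/c^2)
  refine ⟨(c/(120*K))^4, by positivity, M0 + 2, by omega, fun m hm => ?_⟩
  by_contra hcon
  push Not at hcon
  have hmM : (M0:ℝ) ≤ m := by exact_mod_cast (by omega : M0 ≤ m)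
  have hm1 : (1:ℝ) ≤ m := by exact_mod_cast (by omega : 1 ≤ m)
  have hk1 : 144*(22/(K:ℝ)) ≤ c^2/32 := by
    rw [div_lt_iff₀ (by positivity)] at hK
    rw [← mul_div_assoc, div_le_div_iff₀ hKpos (by norm_num)]
    linarith
  have hm2 : 81*((K:ℝ)+3)^2 ≤ (c^2/32) * m := by
    have := hM0.trans_le hmM
    rw [div_lt_iff₀ (by positivity)] at this
    have e : c^2/32*(m:ℝ) = (m*c^2)/32 := by ring
    rw [e, le_div_iff₀ (by norm_num)]
    exact this.le
  have main := Q_main m K (by omega) hK0 (c/(120*K)) (c*m/4) (by positivity) hcon.le (by positivity) (by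
    have h1 : 144*(m:ℝ)^2*(22/K) ≤ m^2 * (c^2/32) := by
      have := mul_le_mul_of_nonneg_left hk1 (sq_nonneg (m:ℝ)); linarith
    have h2 : (72*(m:ℝ)+9)*((K:ℝ)+3)^2 ≤ m^2*(c^2/32) := by
      calc (72*(m:ℝ)+9)*((K:ℝ)+3)^2 ≤ (81*m)*((K:ℝ)+3)^2 := by gcongr; linarith
        _ = m * (81*((K:ℝ)+3)^2) := by ring
        _ ≤ m * ((c^2/32)*m) := by gcongr
        _ = _ := by ring
    refine (add_le_add h1 h2).trans (le_of_eq ?_); ring)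
  have e1 : (m:ℝ)/(3*2^14) = c*m := by rw [hc]; ring
  have e2 : 2 * ((K:ℝ) * (15*m*(c/(120*K)))) = c*m/4 := by field_simp; norm_num
  rw [e1, e2] at main
  have : 0 < c*m := by positivity
  linarith

open MeasureTheory ProbabilityTheory Set
set_option linter.unusedSimpArgs false

section Pi4
variable {α : Type*} [MeasurableSpace α] {μ : Measure α} [IsProbabilityMeasure μ] {s : α → α → ℝ}

lemma pi_succ (k : ℕ) {F : (Fin (k+1) → α) → ℝ} (hF : Measurable F) {M : ℝ} (hM : ∀ x, |F x| ≤ M) :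
    ∫ D, F D ∂(Measure.pi fun _ : Fin (k+1) => μ)
      = ∫ a, ∫ D, F (Fin.cons a D) ∂(Measure.pi fun _ : Fin k => μ) ∂μ := by
  have h := (measurePreserving_piFinSuccAbove (fun _ : Fin (k+1) => μ) 0).symm
  rw [← mp_int h hF.aestronglyMeasurable]
  rw [integral_prod]
  · have e : ∀ (a : α) (D : Fin k → α), (MeasurableEquiv.piFinSuccAbove (fun _ => α) 0).symm (a, D)
        = (Fin.cons a D : Fin (k+1) → α) := by
      intro a D
      exact Fin.insertNth_zero' a D
    simp only [e]
  · exact bint (hF.comp (MeasurableEquiv.measurable _)) (fun x => hM _)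

lemma cons_meas (k : ℕ) (a : α) : Measurable fun D : Fin k → α => (Fin.cons a D : Fin (k+1) → α) := by
  refine measurable_pi_iff.2 fun i => ?_
  refine Fin.cases ?_ (fun j => ?_) i
  · simp
  · simpa using measurable_pi_apply j

lemma pi4 {F : (Fin 4 → α) → ℝ} (hF : Measurable F) {M : ℝ} (hM : ∀ x, |F x| ≤ M) :
    ∫ D, F D ∂(Measure.pi fun _ : Fin 4 => μ) = ∫ a, ∫ b, ∫ c, ∫ d, F ![a, b, c, d] ∂μ ∂μ ∂μ ∂μ := by
  rw [pi_succ 3 hF hM]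
  congr 1; funext a
  have h1 := hF.comp (cons_meas 3 a)
  rw [pi_succ 2 (F := fun D => F (Fin.cons a D)) h1 (fun _ => hM _)]
  congr 1; funext b
  have h2 := h1.comp (cons_meas 2 b)
  rw [pi_succ 1 (F := fun D => F (Fin.cons a (Fin.cons b D))) h2 (fun _ => hM _)]
  congr 1; funext c
  have h3 := h2.comp (cons_meas 1 c)
  rw [pi_succ 0 (F := fun D => F (Fin.cons a (Fin.cons b (Fin.cons c D)))) h3 (fun _ => hM _)]
  congr 1; funext d
  rw [Measure.pi_of_empty, integral_dirac]
  rfl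

lemma pi_perm (σ : Equiv.Perm (Fin 4)) {F : (Fin 4 → α) → ℝ} (hF : Measurable F) :
    ∫ D, F (fun i => D (σ i)) ∂(Measure.pi fun _ : Fin 4 => μ) = ∫ D, F D ∂(Measure.pi fun _ : Fin 4 => μ) := by
  have h := measurePreserving_piCongrLeft (fun _ : Fin 4 => μ) σ.symm
  rw [← mp_int h hF.aestronglyMeasurable]
  congr 1; funext D; congr 1; funext i
  have := Equiv.piCongrLeft_apply_apply (fun _ : Fin 4 => α) σ.symm D (σ i)
  simp only [Equiv.symm_apply_apply] at this
  exact this.symm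

lemma s_ev (hs : Measurable fun p : α × α => s p.1 p.2) (i j : Fin 4) :
    Measurable fun D : Fin 4 → α => s (D i) (D j) :=
  meas2 hs (u := fun D : Fin 4 → α => D i) (v := fun D => D j) (by fun_prop) (by fun_prop)

lemma E_path (hs : Measurable fun p : α × α => s p.1 p.2) (hb : ∀ A B, |s A B| ≤ 1)
    (σ : Equiv.Perm (Fin 4)) :
    0 ≤ ∫ D, s (D (σ 0)) (D (σ 1)) * s (D (σ 0)) (D (σ 2)) ∂(Measure.pi fun _ : Fin 4 => μ) := by
  have hm := (s_ev hs 0 1).fun_mul (s_ev hs 0 2)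
  rw [pi_perm (μ := μ) σ (F := fun D : Fin 4 → α => s (D 0) (D 1) * s (D 0) (D 2)) hm,
    pi4 hm (fun D => mul_bd (hb _ _) (hb _ _))]
  refine integral_nonneg fun a => ?_
  simp [integral_const_mul, integral_mul_const]
  exact mul_self_nonneg _

lemma E_cyc (hs : Measurable fun p : α × α => s p.1 p.2) (hb : ∀ A B, |s A B| ≤ 1) (ha : ∀ A B, s A B = - s B A)
    (σ : Equiv.Perm (Fin 4)) :
    ∫ D, s (D (σ 0)) (D (σ 1)) * s (D (σ 1)) (D (σ 2)) * s (D (σ 2)) (D (σ 3)) * s (D (σ 3)) (D (σ 0))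
      ∂(Measure.pi fun _ : Fin 4 => μ) = QQ μ s := by
  have hm := (((s_ev hs 0 1).fun_mul (s_ev hs 1 2)).fun_mul (s_ev hs 2 3)).fun_mul (s_ev hs 3 0)
  rw [pi_perm (μ := μ) σ (F := fun D : Fin 4 → α => s (D 0) (D 1) * s (D 1) (D 2) * s (D 2) (D 3) * s (D 3) (D 0)) hm,
    pi4 hm (fun D => mul_bd (mul_bd (mul_bd (hb _ _) (hb _ _)) (hb _ _)) (hb _ _))]
  unfold QQ
  congr 1; funext a
  have e : ∀ b c d, s a b * s b c * s c d * s d a = (s a b * s c b) * (s a d * s c d) := by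
    intro b c d; rw [ha b c, ha d a]; ring
  have e1 : ∫ b, ∫ c, ∫ d, s a b * s b c * s c d * s d a ∂μ ∂μ ∂μ = ∫ b, ∫ c, (s a b * s c b) * hh μ s a c ∂μ ∂μ := by
    simp only [e, integral_const_mul]; rfl
  refine (show _ = _ from e1).trans ?_
  have hm2 : Measurable fun p : α × α => (s a p.1 * s p.2 p.1) * hh μ s a p.2 :=
    ((meas2 hs (u := fun p : α × α => a) (v := fun p => p.1) (by fun_prop) (by fun_prop)).fun_mul
      (meas2 hs (u := fun p : α × α => p.2) (v := fun p => p.1) (by fun_prop) (by fun_prop))).fun_mul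
      (meas2 (hh_meas hs) (u := fun p : α × α => a) (v := fun p => p.2) (by fun_prop) (by fun_prop))
  rw [bswap (F := fun b c => (s a b * s c b) * hh μ s a c) hm2 (fun b c => mul_bd (mul_bd (hb _ _) (hb _ _)) (hh_bd hb _ _))]
  congr 1; funext c
  rw [integral_mul_const, sq]; rfl

end Pi4

/-- the transitivity polynomial -/
def tpoly {R : Type*} [Ring R] (w : Fin 4 → Fin 4 → R) : R :=
  3 + (w 0 1 * w 0 2 + w 0 1 * w 0 3 + w 0 2 * w 0 3)
    + (w 1 0 * w 1 2 + w 1 0 * w 1 3 + w 1 2 * w 1 3)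
    + (w 2 0 * w 2 1 + w 2 0 * w 2 3 + w 2 1 * w 2 3)
    + (w 3 0 * w 3 1 + w 3 0 * w 3 2 + w 3 1 * w 3 2)
    + (w 0 1 * w 1 2 * w 2 3 * w 3 0 + w 0 1 * w 1 3 * w 3 2 * w 2 0 + w 0 2 * w 2 1 * w 1 3 * w 3 0)

/-- tournament from six bits -/
def tourB (a b c d e f : Bool) : Fin 4 → Fin 4 → Bool :=
  ![![false, a, b, c], ![!a, false, d, e], ![!b, !d, false, f], ![!c, !e, !f, false]]

set_option maxRecDepth 100000 in
set_option maxHeartbeats 4000000 in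
lemma tour_dec : ∀ a b c d e f : Bool,
    tpoly (fun i j => if tourB a b c d e f i j then (1:ℤ) else -1) ≤ 8 ∧
    (tpoly (fun i j => if tourB a b c d e f i j then (1:ℤ) else -1) ≤ 0 ∨
     ∃ x y z w : Fin 4, tourB a b c d e f x y = true ∧ tourB a b c d e f x z = true ∧ tourB a b c d e f x w = true
      ∧ tourB a b c d e f y z = true ∧ tourB a b c d e f y w = true ∧ tourB a b c d e f z w = true) := by
  decide

lemma tour_real (R : Fin 4 → Fin 4 → Prop) (w : Fin 4 → Fin 4 → ℝ) (h1 : ∀ i j, R i j → w i j = 1)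
    (h2 : ∀ i j, i ≠ j → ¬ R i j → w i j = -1) (h3 : ∀ i j, i ≠ j → (R i j ↔ ¬ R j i)) (h4 : ∀ i, ¬ R i i) :
    tpoly w ≤ 8 ∧ (tpoly w ≤ 0 ∨ ∃ σ : Equiv.Perm (Fin 4), ∀ i j, i < j → R (σ i) (σ j)) := by
  classical
  have key := tour_dec (decide (R 0 1)) (decide (R 0 2)) (decide (R 0 3)) (decide (R 1 2)) (decide (R 1 3)) (decide (R 2 3))
  set t := tourB (decide (R 0 1)) (decide (R 0 2)) (decide (R 0 3)) (decide (R 1 2)) (decide (R 1 3)) (decide (R 2 3)) with ht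
  have ht2 : ∀ i j, t i j = true ↔ R i j := by
    have a1 := h3 1 0 (by decide)
    have a2 := h3 2 0 (by decide)
    have a3 := h3 3 0 (by decide)
    have a4 := h3 2 1 (by decide)
    have a5 := h3 3 1 (by decide)
    have a6 := h3 3 2 (by decide)
    have d0 := h4 0
    have d1 := h4 1
    have d2 := h4 2
    have d3 := h4 3
    intro i j
    fin_cases i <;> fin_cases j <;> simp [ht, tourB, a1, a2, a3, a4, a5, a6, d0, d1, d2, d3]
  clear_value t
  have hw : ∀ i j, i ≠ j → w i j = ((if t i j then (1:ℤ) else -1 : ℤ) : ℝ) := by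
    intro i j hij
    by_cases h : R i j
    · rw [h1 i j h, if_pos ((ht2 i j).2 h)]; simp
    · rw [h2 i j hij h, if_neg (fun h' => h ((ht2 i j).1 h'))]; simp
  have e : tpoly w = ((tpoly (fun i j => if t i j then (1:ℤ) else -1) : ℤ) : ℝ) := by
    unfold tpoly
    rw [hw 0 1 (by decide), hw 0 2 (by decide), hw 0 3 (by decide), hw 1 0 (by decide), hw 1 2 (by decide), hw 1 3 (by decide),
      hw 2 0 (by decide), hw 2 1 (by decide), hw 2 3 (by decide), hw 3 0 (by decide), hw 3 1 (by decide), hw 3 2 (by decide)]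
    push_cast
    ring
  rw [e]
  refine ⟨by exact_mod_cast key.1, ?_⟩
  rcases key.2 with h | ⟨x, y, z, v, hh⟩
  · left; exact_mod_cast h
  · right
    simp only [ht2] at hh
    obtain ⟨k1, k2, k3, k4, k5, k6⟩ := hh
    have hne : ∀ {p q}, R p q → p ≠ q := fun {p q} h hpq => h4 p (by rw [← hpq] at h; exact h)
    have key : ∀ i j, i < j → R (![x, y, z, v] i) (![x, y, z, v] j) := by
      intro i j hij
      fin_cases i <;> fin_cases j <;> first | exact absurd hij (by decide) | simpa
    have inj : Function.Injective ![x, y, z, v] := by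
      intro i j hij
      by_contra hn
      rcases lt_or_gt_of_ne hn with h | h
      · exact hne (key _ _ h) hij
      · exact hne (key _ _ h) hij.symm
    exact ⟨Equiv.ofBijective _ (Finite.injective_iff_bijective.1 inj), fun i j hij => key i j hij⟩

open MeasureTheory ProbabilityTheory Set
set_option linter.unusedSimpArgs false

def TT (m : ℕ) : Set (Fin 4 → PD m) :=
  {D | ∃ σ : Equiv.Perm (Fin 4), ∀ i j : Fin 4, i < j → 0 < Xf (D (σ i)) (D (σ j))}

lemma TT_meas (m : ℕ) : MeasurableSet (TT m) := by
  have : TT m = ⋃ σ : Equiv.Perm (Fin 4), ⋂ i, ⋂ j, ⋂ (_ : i < j), {D | 0 < Xf (D (σ i)) (D (σ j))} := by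
    ext D; simp [TT]
  rw [this]
  refine MeasurableSet.iUnion fun σ => MeasurableSet.iInter fun i => MeasurableSet.iInter fun j =>
    MeasurableSet.iInter fun _ => ?_
  exact measurableSet_lt measurable_const (s_ev (s := Xf) (Xf_meas m) (σ i) (σ j))

lemma four_ae_ne (m : ℕ) : ∀ᵐ D ∂(Measure.pi fun _ : Fin 4 => nuM (m+1)), ∀ i j, i ≠ j → Xf (D i) (D j) ≠ 0 := by
  rw [ae_all_iff]; intro i
  rw [ae_all_iff]; intro j
  by_cases hij : i = j
  · simp [hij]
  simp only [ne_eq, hij, not_false_eq_true, true_implies]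
  have hm : MeasurableSet {D : Fin 4 → PD (m+1) | Xf (D i) (D j) ≠ 0} :=
    ((s_ev (s := Xf) (Xf_meas (m+1)) i j) (measurableSet_singleton 0)).compl
  have hm2 : Measurable fun D : Fin 4 → PD (m+1) => {p : PD (m+1) × PD (m+1) | Xf p.1 p.2 = 0}.indicator (fun _ => (1:ℝ)) (D i, D j) := by
    refine (Measurable.indicator measurable_const ?_).comp (by fun_prop)
    exact (Xf_meas (m+1)) (measurableSet_singleton 0)
  have ind : iIndepFun (fun (i : Fin 4) (D : Fin 4 → PD (m+1)) => D i) (Measure.pi fun _ : Fin 4 => nuM (m+1)) :=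
    iIndepFun_pi (X := fun _ x => x) (fun i => aemeasurable_id)
  have ip := (ind.indepFun hij)
  have hp : (Measure.pi fun _ : Fin 4 => nuM (m+1)).map (fun D => (D i, D j)) = (nuM (m+1)).prod (nuM (m+1)) := by
    rw [(indepFun_iff_map_prod_eq_prod_map_map (measurable_pi_apply i).aemeasurable (measurable_pi_apply j).aemeasurable).1 ip]
    rw [(measurePreserving_eval (fun _ : Fin 4 => nuM (m+1)) i).map_eq, (measurePreserving_eval (fun _ : Fin 4 => nuM (m+1)) j).map_eq]
  have h := pair_ae_ne m
  rw [← hp] at h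
  filter_upwards [ae_of_ae_map (by fun_prop) h] with D hD
  exact X_ne_zero hD

noncomputable def p3 (a b c : Fin 4) (h : Function.Injective ![a, b, c, 6 - a - b - c]) : Equiv.Perm (Fin 4) :=
  Equiv.ofBijective _ (Finite.injective_iff_bijective.1 h)

lemma E_path' {α : Type*} [MeasurableSpace α] {μ : Measure α} [IsProbabilityMeasure μ] {s : α → α → ℝ}
    (hs : Measurable fun p : α × α => s p.1 p.2) (hb : ∀ A B, |s A B| ≤ 1) (a b c : Fin 4)
    (h : Function.Injective ![a, b, c, 6 - a - b - c]) :
    0 ≤ ∫ D, s (D a) (D b) * s (D a) (D c) ∂(Measure.pi fun _ : Fin 4 => μ) :=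
  E_path hs hb (p3 a b c h)

lemma E_cyc' {α : Type*} [MeasurableSpace α] {μ : Measure α} [IsProbabilityMeasure μ] {s : α → α → ℝ}
    (hs : Measurable fun p : α × α => s p.1 p.2) (hb : ∀ A B, |s A B| ≤ 1) (ha : ∀ A B, s A B = - s B A) (a b c : Fin 4)
    (h : Function.Injective ![a, b, c, 6 - a - b - c]) :
    ∫ D, s (D a) (D b) * s (D b) (D c) * s (D c) (D (6 - a - b - c)) * s (D (6 - a - b - c)) (D a) ∂(Measure.pi fun _ : Fin 4 => μ) = QQ μ s :=
  E_cyc hs hb ha (p3 a b c h)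

lemma E_tpoly {α : Type*} [MeasurableSpace α] {μ : Measure α} [IsProbabilityMeasure μ] {s : α → α → ℝ}
    (hs : Measurable fun p : α × α => s p.1 p.2) (hb : ∀ A B, |s A B| ≤ 1) (ha : ∀ A B, s A B = - s B A) :
    Integrable (fun D : Fin 4 → α => tpoly (fun i j => s (D i) (D j))) (Measure.pi fun _ : Fin 4 => μ) ∧
    3 + 3 * QQ μ s ≤ ∫ D : Fin 4 → α, tpoly (fun i j => s (D i) (D j)) ∂(Measure.pi fun _ : Fin 4 => μ) := by
  set P := Measure.pi fun _ : Fin 4 => μ with hP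
  have ip : ∀ a b c : Fin 4, Integrable (fun D : Fin 4 → α => s (D a) (D b) * s (D a) (D c)) P := fun a b c =>
    bint ((s_ev hs a b).fun_mul (s_ev hs a c)) (fun D => mul_bd (hb _ _) (hb _ _))
  have ic : ∀ a b c d : Fin 4, Integrable (fun D : Fin 4 → α => s (D a) (D b) * s (D b) (D c) * s (D c) (D d) * s (D d) (D a)) P :=
    fun a b c d => bint ((((s_ev hs a b).fun_mul (s_ev hs b c)).fun_mul (s_ev hs c d)).fun_mul (s_ev hs d a))
      (fun D => mul_bd (mul_bd (mul_bd (hb _ _) (hb _ _)) (hb _ _)) (hb _ _))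
  have hadd : ∀ {f g : (Fin 4 → α) → ℝ} {v w : ℝ},
      (Integrable f P ∧ ∫ D, f D ∂P = v) → (Integrable g P ∧ ∫ D, g D ∂P = w) →
      (Integrable (fun D => f D + g D) P ∧ ∫ D, (f D + g D) ∂P = v + w) := by
    intro f g v w hf hg
    exact ⟨hf.1.add hg.1, by rw [integral_add hf.1 hg.1, hf.2, hg.2]⟩
  have ip2 := fun a b c => And.intro (ip a b c) (Eq.refl (∫ D : Fin 4 → α, s (D a) (D b) * s (D a) (D c) ∂P))
  have ic2 := fun a b c d => And.intro (ic a b c d) (Eq.refl (∫ D : Fin 4 → α, s (D a) (D b) * s (D b) (D c) * s (D c) (D d) * s (D d) (D a) ∂P))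
  have i3 := fun a b c d => hadd (hadd (ip2 a b c) (ip2 a b d)) (ip2 a c d)
  have j0 : Integrable (fun _ : Fin 4 → α => (3:ℝ)) P ∧ ∫ _ : Fin 4 → α, (3:ℝ) ∂P = 3 := ⟨integrable_const _, by simp⟩
  have j := hadd (hadd (hadd (hadd (hadd j0 (i3 0 1 2 3)) (i3 1 0 2 3)) (i3 2 0 1 3)) (i3 3 0 1 2))
    (hadd (hadd (ic2 0 1 2 3) (ic2 0 1 3 2)) (ic2 0 2 1 3))
  refine ⟨j.1, ?_⟩
  refine le_of_le_of_eq ?_ j.2.symm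
  have c1 := E_cyc' (μ := μ) hs hb ha 0 1 2 (by decide)
  have c2 := E_cyc' (μ := μ) hs hb ha 0 1 3 (by decide)
  have c3 := E_cyc' (μ := μ) hs hb ha 0 2 1 (by decide)
  have f1 : (6 - 0 - 1 - 2 : Fin 4) = 3 := by decide
  have f2 : (6 - 0 - 1 - 3 : Fin 4) = 2 := by decide
  have f3 : (6 - 0 - 2 - 1 : Fin 4) = 3 := by decide
  rw [f1] at c1; rw [f2] at c2; rw [f3] at c3
  rw [c1, c2, c3]
  have p := E_path' (μ := μ) hs hb
  have a1 := p 0 1 2 (by decide)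
  have a2 := p 0 1 3 (by decide)
  have a3 := p 0 2 3 (by decide)
  have b1 := p 1 0 2 (by decide)
  have b2 := p 1 0 3 (by decide)
  have b3 := p 1 2 3 (by decide)
  have d1 := p 2 0 1 (by decide)
  have d2 := p 2 0 3 (by decide)
  have d3 := p 2 1 3 (by decide)
  have g1 := p 3 0 1 (by decide)
  have g2 := p 3 0 2 (by decide)
  have g3 := p 3 1 2 (by decide)
  linarith

lemma TT_prob (m : ℕ) : ENNReal.ofReal ((3 + 3 * QQ (nuM (m+1)) ss) / 8) ≤ (Measure.pi fun _ : Fin 4 => nuM (m+1)) (TT (m+1)) := by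
  obtain ⟨hi, hE⟩ := E_tpoly (μ := nuM (m+1)) (s := ss) (ss_meas _) ss_bd ss_antisymm
  set P := Measure.pi fun _ : Fin 4 => nuM (m+1) with hP
  have hle : ∫ D : Fin 4 → PD (m+1), tpoly (fun i j => ss (D i) (D j)) ∂P ≤ ∫ D, (TT (m+1)).indicator (fun _ => (8:ℝ)) D ∂P := by
    refine integral_mono_ae hi ((integrable_const _).indicator (TT_meas _)) ?_
    filter_upwards [four_ae_ne m] with D hD
    have hself : ∀ i, Xf (D i) (D i) = 0 := fun i => by linarith [Xf_antisymm (D i) (D i)]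
    have := tour_real (fun i j => 0 < Xf (D i) (D j)) (fun i j => ss (D i) (D j))
      (fun i j h => by simp [ss, sg, h, not_lt.2 h.le])
      (fun i j hij h => by
        have h' := lt_of_le_of_ne (not_lt.1 h) (hD i j hij)
        simp [ss, sg, h', not_lt.2 h'.le])
      (fun i j hij => by
        have := Xf_antisymm (D i) (D j)
        have h' := hD i j hij
        constructor
        · intro h; linarith
        · intro h
          refine lt_of_le_of_ne (by linarith) h'.symm)
      (fun i => by simp [hself i])
    by_cases hT : D ∈ TT (m+1)
    · rw [indicator_of_mem hT]; exact this.1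
    · rw [indicator_of_notMem hT]
      rcases this.2 with h | h
      · exact h
      · exact absurd h hT
  rw [integral_indicator_const _ (TT_meas _)] at hle
  have : (3 + 3 * QQ (nuM (m+1)) ss) / 8 ≤ P.real (TT (m+1)) := by
    simp only [smul_eq_mul] at hle
    linarith
  exact ENNReal.ofReal_le_of_le_toReal this

open MeasureTheory ProbabilityTheory Set
set_option linter.unusedSimpArgs false

lemma cond_mp {α β : Type*} [MeasurableSpace α] [MeasurableSpace β] {μ : Measure α} {ν : Measure β} {T : α → β}
    (hT : MeasurePreserving T μ ν) {H : Set β} (hH : MeasurableSet H) :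
    MeasurePreserving T (ProbabilityTheory.cond μ (T ⁻¹' H)) (ProbabilityTheory.cond ν H) := by
  refine ⟨hT.measurable, ?_⟩
  unfold ProbabilityTheory.cond
  rw [Measure.map_smul, (hT.restrict_preimage hH).map_eq, hT.measure_preimage hH.nullMeasurableSet]

def eqv (m : ℕ) : Fin m ⊕ Fin m ≃ Fin (2*m+1-1) := finSumFinEquiv.trans (finCongr (by omega))

noncomputable def Tm (m : ℕ) (A : PD m) : Fin (2*m+1-1) → ℝ := fun k => Sum.elim A.1 A.2 ((eqv m).symm k)

lemma Tm_mp (m : ℕ) : MeasurePreserving (Tm m) (Lm m) (Measure.pi fun _ => lam) := by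
  have h1 := measurePreserving_sumPiEquivProdPi_symm (X := fun _ : Fin m ⊕ Fin m => ℝ) (fun _ => lam)
  have h2 := measurePreserving_piCongrLeft (fun _ : Fin (2*m+1-1) => lam) (eqv m)
  have h := h2.comp h1
  have e : Tm m = (MeasurableEquiv.piCongrLeft (fun _ : Fin (2*m+1-1) => ℝ) (eqv m)) ∘
      (MeasurableEquiv.sumPiEquivProdPi (fun _ : Fin m ⊕ Fin m => ℝ)).symm := by
    funext A k
    obtain ⟨j, rfl⟩ := (eqv m).surjective k
    have := Equiv.piCongrLeft_apply_apply (fun _ : Fin (2*m+1-1) => ℝ) (eqv m)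
      ((MeasurableEquiv.sumPiEquivProdPi (fun _ : Fin m ⊕ Fin m => ℝ)).symm A) j
    refine Eq.trans ?_ this.symm
    unfold Tm
    rw [Equiv.symm_apply_apply]
    rcases j with j | j <;> rfl
  rw [e]
  exact h

lemma Tm_sum {m : ℕ} (f : ℝ → ℝ) (A : PD m) : ∑ k, f (Tm m A k) = (∑ i, f (A.1 i)) + ∑ i, f (A.2 i) := by
  rw [← (eqv m).sum_comp]
  simp [Tm, Fintype.sum_sum_type]

lemma Tm_last {m : ℕ} (A : PD m) : (((2*m+1:ℕ):ℝ)/2 - ∑ k, Tm m A k) = lastF A := by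
  have := Tm_sum (fun x => x) A
  rw [this]
  simp only [lastF, dev, Finset.sum_sub_distrib]
  simp
  ring

noncomputable def gm (m : ℕ) (A : PD m) : Fin (2*m+1) → ℝ := extendDie (2*m+1) (((2*m+1:ℕ):ℝ)/2) (Tm m A)

lemma gm_sum {m : ℕ} (f : ℝ → ℝ) (A : PD m) : ∑ k, f (gm m A k) = fs f A := by
  rw [Fin.sum_univ_castSucc, fs_expand, ← add_assoc, ← Tm_sum]
  have h1 : ∀ i : Fin (2*m), gm m A i.castSucc = Tm m A i := by
    intro i
    unfold gm extendDie
    rw [dif_pos (show ((i.castSucc : Fin (2*m+1)) : ℕ) < 2*m+1-1 by simp)]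
    rfl
  have h2 : gm m A (Fin.last (2*m)) = lastF A := by
    unfold gm extendDie
    rw [dif_neg (by simp)]
    exact Tm_last A
  rw [h2]
  simp only [h1]
  rfl

lemma extendDie_meas (n : ℕ) (s : ℝ) : Measurable (extendDie n s) := by
  refine measurable_pi_iff.2 fun i => ?_
  unfold extendDie
  by_cases h : (i:ℕ) < n - 1
  · simp only [h, dif_pos]; fun_prop
  · simp only [h, dif_neg, not_false_eq_true]; fun_prop

lemma gm_meas (m : ℕ) : Measurable (gm m) := (extendDie_meas _ _).comp (Tm_mp m).measurable

lemma dice_eq (m : ℕ) : diceMeasure (2*m+1) 0 1 (((2*m+1:ℕ):ℝ)/2) = (nuM m).map (gm m) := by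
  set c : ℝ := ((2*m+1:ℕ):ℝ)/2 with hc
  set H : Set (Fin (2*m+1-1) → ℝ) := {a | (c - ∑ i, a i) ∈ Icc (0:ℝ) 1} with hH
  have hHm : MeasurableSet H := by
    have : Measurable fun a : Fin (2*m+1-1) → ℝ => c - ∑ i, a i := by fun_prop
    exact this measurableSet_Icc
  have hcond : ProbabilityTheory.cond volume {a : Fin (2*m+1 - 1) → ℝ | (∀ i, a i ∈ Set.Icc (0:ℝ) 1) ∧ (c - ∑ i, a i) ∈ Set.Icc (0:ℝ) 1}
      = ProbabilityTheory.cond (Measure.pi fun _ => lam) H := by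
    have e1 : {a : Fin (2*m+1 - 1) → ℝ | (∀ i, a i ∈ Set.Icc (0:ℝ) 1) ∧ (c - ∑ i, a i) ∈ Set.Icc (0:ℝ) 1}
        = H ∩ Set.pi univ (fun _ => Icc (0:ℝ) 1) := by
      ext a
      simp only [hH, mem_inter_iff, mem_pi, mem_univ, true_implies, Set.mem_ofPred_eq]
      tauto
    have e2 : (Measure.pi fun _ : Fin (2*m+1-1) => lam) = volume.restrict (Set.pi univ (fun _ => Icc (0:ℝ) 1)) := by
      rw [volume_pi, Measure.restrict_pi_pi]; rfl
    rw [e1, e2]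
    unfold ProbabilityTheory.cond
    rw [Measure.restrict_restrict hHm, Measure.restrict_apply hHm]
  have hpre : Tm m ⁻¹' H = Em m := by
    ext A
    simp only [hH, mem_preimage, Set.mem_ofPred_eq, Em]
    rw [hc, Tm_last]
    unfold lastF
    simp only [mem_Icc]
    constructor <;> rintro ⟨h1, h2⟩ <;> constructor <;> linarith
  unfold diceMeasure
  rw [hcond, ← (cond_mp (Tm_mp m) hHm).map_eq, hpre, Measure.map_map (extendDie_meas _ _) (Tm_mp m).measurable]
  rfl

lemma beats_iff {m : ℕ} (A B : PD m) : beats (gm m A) (gm m B) ↔ 0 < Xf A B := by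
  have : Xf A B = ∑ i, ∑ j, sg (gm m A i) (gm m B j) := by
    unfold Xf
    rw [← gm_sum]
    refine Finset.sum_congr rfl fun i _ => ?_
    rw [← gm_sum]
  rw [this]
  rfl

lemma main_odd (m : ℕ) : (Measure.pi fun _ : Fin 4 => nuM m) (TT m) ≤
    (Measure.pi fun _ : Fin 4 => diceMeasure (2*m+1) 0 1 (((2*m+1:ℕ):ℝ)/2)) {D | transitiveOnFour D} := by
  rw [dice_eq]
  have hg := gm_meas m
  haveI : IsProbabilityMeasure ((nuM m).map (gm m)) := Measure.isProbabilityMeasure_map hg.aemeasurable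
  have h := Measure.pi_map_pi (μ := fun _ : Fin 4 => nuM m) (f := fun _ => gm m) (fun _ => hg.aemeasurable)
  rw [← h]
  have hm : Measurable fun (x : Fin 4 → PD m) i => gm m (x i) :=
    measurable_pi_iff.2 fun i => hg.comp (measurable_pi_apply i)
  refine le_trans (measure_mono ?_) (Measure.le_map_apply hm.aemeasurable _)
  intro D hD
  obtain ⟨σ, hσ⟩ := hD
  exact ⟨σ, fun i j hij => (beats_iff _ _).2 (hσ i j hij)⟩

theorem four_dice_transitive_gt :
    ∃ ε > (0 : ℝ), ∃ N : ℕ, ∀ n : ℕ, N ≤ n → Odd n →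
      (Measure.pi fun _ : Fin 4 => diceMeasure n 0 1 ((n : ℝ) / 2))
          {D : Fin 4 → Fin n → ℝ | transitiveOnFour D}
        > ENNReal.ofReal (3 / 8 + ε) := by
  obtain ⟨q0, hq0, M0, hM2, hQ⟩ := Q_lower
  refine ⟨q0 / 4, by positivity, 2 * M0 + 1, ?_⟩
  rintro n hn ⟨m, rfl⟩
  have hm : M0 ≤ m := by omega
  refine lt_of_lt_of_le ?_ (main_odd m)
  obtain ⟨k, rfl⟩ : ∃ k, m = k + 1 := ⟨m - 1, by omega⟩
  refine lt_of_lt_of_le ?_ (TT_prob k)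
  have := hQ (k+1) hm
  rw [ENNReal.ofReal_lt_ofReal_iff (by linarith)]
  linarith
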